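/- Let n ≥ 2, α ∈ (0,1), and let f : S^n → (0,∞) be a positive α-Hölder continuous function, extended to ℝ^{n+1}\{0} as a function homogeneous of degree −1. Let u : ℝ^{n+1} → ℝ be continuous, homogeneous of degree 1, of class C² on ℝ^{n+1}\{0}, and satisfy Δu = f on ℝ^{n+1}\{0}. Then u is convex on ℝ^{n+1} if and only if for all x, ξ ∈ S^n with ⟨ξ, x⟩ = 0, ∫_{S^n} ω̂(x,ξ,z) ( f(z) − f(x) ) dσ(z) + f(x)/n ≥ 0, where ω̂(x,ξ,z) = (1/ω_n) ∫_0^∞ [ ( |x − rz|² − (n+1) ⟨ξ, rz⟩² ) / |x − rz|^{n+3} ] r^{n−1} dr, and the integral over S^n is absolutely convergent. -/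

import Mathlib

open MeasureTheory Metric Set
open scoped RealInnerProductSpace

/-- The Euclidean Laplacian of `u : ℝ^m → ℝ`, as the sum of second partial
derivatives along the standard coordinate directions. -/
noncomputable def laplacian {m : ℕ} (u : EuclideanSpace ℝ (Fin m) → ℝ)
    (x : EuclideanSpace ℝ (Fin m)) : ℝ :=
  ∑ i, fderiv ℝ (fun y => fderiv ℝ u y (EuclideanSpace.single i 1)) x (EuclideanSpace.single i 1)

/-- The surface measure on the unit sphere `Sⁿ ⊂ ℝ^{n+1}`. -/
noncomputable def sphereMeasure (n : ℕ) :
    Measure (sphere (0 : EuclideanSpace ℝ (Fin (n + 1))) 1) :=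
  (volume : Measure (EuclideanSpace ℝ (Fin (n + 1)))).toSphere

/-- `ω_n`, the total surface measure of the unit sphere `Sⁿ ⊂ ℝ^{n+1}`. -/
noncomputable def omega_n (n : ℕ) : ℝ := (sphereMeasure n Set.univ).toReal

/-- The kernel `ω̂(x,ξ,z) = (1/ω_n) ∫₀^∞ (|x-rz|² - (n+1)⟨ξ,rz⟩²)/|x-rz|^{n+3} · r^{n-1} dr`. -/
noncomputable def omegaHat (n : ℕ) (x ξ z : EuclideanSpace ℝ (Fin (n + 1))) : ℝ :=
  (1 / omega_n n) * ∫ r in Set.Ioi (0 : ℝ),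
    (‖x - r • z‖ ^ 2 - (n + 1) * ⟪ξ, r • z⟫ ^ 2) / ‖x - r • z‖ ^ (n + 3) * r ^ (n - 1)

section

open Filter Topology Module

section IntegrationByParts

variable {E : Type*} [NormedAddCommGroup E] [NormedSpace ℝ E] [FiniteDimensional ℝ E]
  [MeasurableSpace E] [BorelSpace E] {μ : Measure E} [μ.IsAddHaarMeasure]

/-- The directional derivative of a compactly supported `C¹` function has integral zero. -/
theorem integral_fderiv_apply_eq_zero {f : E → ℝ} (hf : ContDiff ℝ 1 f)
    (hc : HasCompactSupport f) (a : E) : ∫ y, fderiv ℝ f y a ∂μ = 0 := by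
  have hcont : Continuous fun y => fderiv ℝ f y a :=
    (hf.continuous_fderiv one_ne_zero).clm_apply continuous_const
  have hi : Integrable (fun y => fderiv ℝ f y a) μ :=
    hcont.integrable_of_hasCompactSupport (hc.fderiv_apply ℝ a)
  have := integral_mul_fderiv_eq_neg_fderiv_mul_of_integrable (μ := μ) (f := fun _ : E => (1 : ℝ))
    (g := f) (v := a) (by simp) (by simpa using hi)
    (by simpa using hf.continuous.integrable_of_hasCompactSupport hc)
    (fun _ _ => differentiableAt_const _) (fun x _ => hf.differentiable one_ne_zero x)
  simpa using this

omit [FiniteDimensional ℝ E] in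
theorem integrable_fderiv_apply_of_hasCompactSupport {f : E → ℝ} (hf : ContDiff ℝ 1 f)
    (hc : HasCompactSupport f) (a : E) : Integrable (fun y => fderiv ℝ f y a) μ :=
  ((hf.continuous_fderiv one_ne_zero).clm_apply continuous_const).integrable_of_hasCompactSupport
    (hc.fderiv_apply ℝ a)

end IntegrationByParts

section Annular

variable {E : Type*} [NormedAddCommGroup E] [InnerProductSpace ℝ E] [FiniteDimensional ℝ E]

/-- A smooth cutoff function equal to `1` on an annulus which exhausts the punctured space
as `k → ∞`. -/
noncomputable def annularCutoff (η : ContDiffBump (0 : E)) (k : ℝ) (y : E) : ℝ :=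
  η (k⁻¹ • y) - η (k • y)

theorem contDiff_annularCutoff (η : ContDiffBump (0 : E)) (k : ℝ) :
    ContDiff ℝ 1 (annularCutoff η k) :=
  (η.contDiff.comp (contDiff_const_smul _)).sub (η.contDiff.comp (contDiff_const_smul _))

theorem abs_annularCutoff_le (η : ContDiffBump (0 : E)) (k : ℝ) (y : E) :
    |annularCutoff η k y| ≤ 1 := by
  have h1 := η.nonneg (x := k⁻¹ • y)
  have h2 := η.le_one (x := k⁻¹ • y)
  have h3 := η.nonneg (x := k • y)
  have h4 := η.le_one (x := k • y)
  rw [annularCutoff, abs_le]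
  constructor <;> linarith

theorem hasCompactSupport_annularCutoff (η : ContDiffBump (0 : E)) {k : ℝ} (hk : 0 < k) :
    HasCompactSupport (annularCutoff η k) :=
  (η.hasCompactSupport.comp_smul (inv_ne_zero hk.ne')).sub (η.hasCompactSupport.comp_smul hk.ne')

theorem annularCutoff_eventuallyEq_zero (η : ContDiffBump (0 : E)) (k : ℝ) :
    annularCutoff η k =ᶠ[𝓝 0] 0 := by
  have h (c : ℝ) : ∀ᶠ y : E in 𝓝 0, η (c • y) = 1 := by
    have : Tendsto (fun y : E => c • y) (𝓝 0) (𝓝 0) := by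
      simpa using (continuous_const_smul c).tendsto (0 : E)
    exact this.eventually η.eventuallyEq_one
  filter_upwards [h k⁻¹, h k] with y h1 h2
  simp [annularCutoff, h1, h2]

theorem fderiv_annularCutoff (η : ContDiffBump (0 : E)) (k : ℝ) (y : E) :
    fderiv ℝ (annularCutoff η k) y
      = k⁻¹ • fderiv ℝ η (k⁻¹ • y) - k • fderiv ℝ η (k • y) := by
  have hd : Differentiable ℝ η := (η.contDiff (n := 1)).differentiable one_ne_zero
  have h (c : ℝ) : DifferentiableAt ℝ (fun y : E => η (c • y)) y :=
    (hd (c • y)).comp y (differentiableAt_id.const_smul c)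
  change fderiv ℝ (fun y => η (k⁻¹ • y) - η (k • y)) y = _
  rw [fderiv_fun_sub (h _) (h _), fderiv_comp_smul, fderiv_comp_smul]

omit [FiniteDimensional ℝ E] in
theorem eventually_inv_smul_mem_nhds_zero {s : Set E} (hs : s ∈ 𝓝 0) (y : E) :
    ∀ᶠ k : ℝ in atTop, k⁻¹ • y ∈ s := by
  have : Tendsto (fun k : ℝ => k⁻¹ • y) atTop (𝓝 0) := by
    simpa using (tendsto_inv_atTop_zero (𝕜 := ℝ)).smul_const y
  exact this.eventually hs

omit [FiniteDimensional ℝ E] in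
theorem eventually_lt_norm_smul (R : ℝ) {y : E} (hy : y ≠ 0) :
    ∀ᶠ k : ℝ in atTop, R < ‖k • y‖ := by
  have hy' := norm_pos_iff.2 hy
  filter_upwards [eventually_gt_atTop (R / ‖y‖), eventually_gt_atTop 0] with k hk hk0
  rwa [norm_smul, Real.norm_of_nonneg hk0.le, ← div_lt_iff₀ hy']

theorem tendsto_annularCutoff (η : ContDiffBump (0 : E)) {y : E} (hy : y ≠ 0) :
    Tendsto (fun k => annularCutoff η k y) atTop (𝓝 1) := by
  refine tendsto_const_nhds.congr' ?_
  filter_upwards [eventually_inv_smul_mem_nhds_zero η.eventuallyEq_one y,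
    eventually_lt_norm_smul η.rOut hy] with k h1 h2
  have h1 : η (k⁻¹ • y) = 1 := h1
  rw [annularCutoff, h1, η.zero_of_le_dist (by simpa using h2.le), sub_zero]

theorem tendsto_fderiv_annularCutoff (η : ContDiffBump (0 : E)) {y : E} (hy : y ≠ 0) :
    Tendsto (fun k => fderiv ℝ (annularCutoff η k) y) atTop (𝓝 0) := by
  refine tendsto_const_nhds.congr' ?_
  filter_upwards [eventually_inv_smul_mem_nhds_zero
    (eventually_eventually_nhds.2 η.eventuallyEq_one) y,
    eventually_lt_norm_smul η.rOut hy] with k h1 h2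
  have h3 : fderiv ℝ η (k⁻¹ • y) = 0 := by
    rw [Filter.EventuallyEq.fderiv_eq (f := fun _ => (1 : ℝ)) h1]
    simp
  have h4 : fderiv ℝ η (k • y) = 0 := by
    have : η =ᶠ[𝓝 (k • y)] fun _ => (0 : ℝ) := by
      filter_upwards [(isOpen_lt continuous_const continuous_norm).mem_nhds h2] with z hz
      exact η.zero_of_le_dist (by simpa using (show η.rOut < ‖z‖ from hz).le)
    rw [this.fderiv_eq]
    simp
  rw [fderiv_annularCutoff, h3, h4]
  simp

theorem exists_norm_fderiv_annularCutoff_le (η : ContDiffBump (0 : E)) :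
    ∃ M, ∀ k, 0 < k → ∀ y ≠ 0, ‖fderiv ℝ (annularCutoff η k) y‖ ≤ M * ‖y‖⁻¹ := by
  have hη : ContDiff ℝ 1 η := η.contDiff
  have hc : HasCompactSupport fun y : E => ‖y‖ * ‖fderiv ℝ η y‖ :=
    (η.hasCompactSupport.fderiv (𝕜 := ℝ)).norm.mul_left
  have hcont : Continuous fun y : E => ‖y‖ * ‖fderiv ℝ η y‖ :=
    continuous_norm.mul (hη.continuous_fderiv one_ne_zero).norm
  obtain ⟨M, hM⟩ := hc.exists_bound_of_continuous hcont
  have key (c : ℝ) (hc : 0 < c) (y : E) (hy : y ≠ 0) :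
      ‖c • fderiv ℝ η (c • y)‖ ≤ M * ‖y‖⁻¹ := by
    have := hM (c • y)
    rw [norm_mul, norm_norm, norm_norm, norm_smul, Real.norm_of_nonneg hc.le] at this
    rw [norm_smul, Real.norm_of_nonneg hc.le, ← div_eq_mul_inv,
      le_div_iff₀ (norm_pos_iff.2 hy)]
    linarith
  refine ⟨M + M, fun k hk y hy => ?_⟩
  rw [fderiv_annularCutoff, add_mul]
  exact (norm_sub_le _ _).trans (add_le_add (key _ (inv_pos.2 hk) y hy) (key _ hk y hy))

end Annular

section PuncturedDivergence

variable {E : Type*} [NormedAddCommGroup E] [InnerProductSpace ℝ E] [FiniteDimensional ℝ E]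
  [MeasurableSpace E] [BorelSpace E] {μ : Measure E} [μ.IsAddHaarMeasure]

theorem aestronglyMeasurable_of_continuousOn_compl_zero [Nontrivial E] {F : Type*}
    [NormedAddCommGroup F] {f : E → F} (hf : ContinuousOn f {0}ᶜ) : AEStronglyMeasurable f μ := by
  have := hf.aestronglyMeasurable (μ := μ) (measurableSet_singleton 0).compl
  rwa [restrict_compl_singleton] at this

theorem ae_ne_zero [Nontrivial E] : ∀ᵐ y ∂μ, y ≠ 0 :=
  compl_mem_ae_iff.2 (measure_singleton _)

/-- The integral over the whole space of the divergence of a vector field which is `C¹` away from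
the origin vanishes, provided that the field is integrable against `‖y‖⁻¹`. -/
theorem integral_fderiv_add_fderiv_eq_zero [Nontrivial E] {p q : E → ℝ} {a b : E}
    (hp : ContDiffOn ℝ 1 p {0}ᶜ) (hq : ContDiffOn ℝ 1 q {0}ᶜ)
    (hpi : Integrable (fun y => p y * ‖y‖⁻¹) μ) (hqi : Integrable (fun y => q y * ‖y‖⁻¹) μ)
    (hi : Integrable (fun y => fderiv ℝ p y a + fderiv ℝ q y b) μ) :
    ∫ y, (fderiv ℝ p y a + fderiv ℝ q y b) ∂μ = 0 := by
  let η : ContDiffBump (0 : E) := default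
  obtain ⟨M, hM⟩ := exists_norm_fderiv_annularCutoff_le η
  have hdiff {h : E → ℝ} (hh : ContDiffOn ℝ 1 h {0}ᶜ) {y : E} (hy : y ≠ 0) :
      DifferentiableAt ℝ h y := (hh.contDiffAt (isOpen_compl_singleton.mem_nhds hy)).differentiableAt
        one_ne_zero
  have hcut {h : E → ℝ} (hh : ContDiffOn ℝ 1 h {0}ᶜ) (k : ℝ) :
      ContDiff ℝ 1 (fun y => annularCutoff η k y * h y) := by
    rw [contDiff_iff_contDiffAt]
    intro y
    rcases eq_or_ne y 0 with rfl | hy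
    · refine (contDiffAt_const (c := (0 : ℝ))).congr_of_eventuallyEq ?_
      filter_upwards [annularCutoff_eventuallyEq_zero η k] with z hz
      simp [hz]
    · exact (contDiff_annularCutoff η k).contDiffAt.mul
        (hh.contDiffAt (isOpen_compl_singleton.mem_nhds hy))
  have hsupp (h : E → ℝ) {k : ℝ} (hk : 0 < k) :
      HasCompactSupport (fun y => annularCutoff η k y * h y) :=
    (hasCompactSupport_annularCutoff η hk).mul_right
  have hfd {h : E → ℝ} (hh : ContDiffOn ℝ 1 h {0}ᶜ) (k : ℝ) (c : E) {y : E} (hy : y ≠ 0) :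
      fderiv ℝ (fun y => annularCutoff η k y * h y) y c
        = annularCutoff η k y * fderiv ℝ h y c + h y * fderiv ℝ (annularCutoff η k) y c := by
    rw [fderiv_fun_mul ((contDiff_annularCutoff η k).differentiable one_ne_zero y) (hdiff hh hy)]
    simp
  have hzero : ∀ k : ℝ, 0 < k → ∫ y, (annularCutoff η k y * (fderiv ℝ p y a + fderiv ℝ q y b) +
      (p y * fderiv ℝ (annularCutoff η k) y a + q y * fderiv ℝ (annularCutoff η k) y b)) ∂μ = 0 := by
    intro k hk
    have h1 := integral_add
      (integrable_fderiv_apply_of_hasCompactSupport (μ := μ) (hcut hp k) (hsupp p hk) a)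
      (integrable_fderiv_apply_of_hasCompactSupport (μ := μ) (hcut hq k) (hsupp q hk) b)
    rw [integral_fderiv_apply_eq_zero (hcut hp k) (hsupp p hk),
      integral_fderiv_apply_eq_zero (hcut hq k) (hsupp q hk), add_zero] at h1
    rw [← h1]
    refine integral_congr_ae ?_
    filter_upwards [ae_ne_zero (μ := μ)] with y hy
    rw [hfd hp k a hy, hfd hq k b hy]
    ring
  have hlim : Tendsto (fun k : ℝ => ∫ y, (annularCutoff η k y * (fderiv ℝ p y a + fderiv ℝ q y b) +
      (p y * fderiv ℝ (annularCutoff η k) y a + q y * fderiv ℝ (annularCutoff η k) y b)) ∂μ) atTop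
      (𝓝 (∫ y, (fderiv ℝ p y a + fderiv ℝ q y b) ∂μ)) := by
    refine tendsto_integral_filter_of_dominated_convergence
      (fun y => |fderiv ℝ p y a + fderiv ℝ q y b| +
        (|p y * ‖y‖⁻¹| * (M * ‖a‖) + |q y * ‖y‖⁻¹| * (M * ‖b‖))) ?_ ?_ ?_ ?_
    · refine Eventually.of_forall fun k => ?_
      have hcc (c : E) : Continuous fun y => fderiv ℝ (annularCutoff η k) y c :=
        ((contDiff_annularCutoff η k).continuous_fderiv one_ne_zero).clm_apply continuous_const
      exact ((contDiff_annularCutoff η k).continuous.aestronglyMeasurable.mul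
        hi.aestronglyMeasurable).add
        (((aestronglyMeasurable_of_continuousOn_compl_zero hp.continuousOn).mul
          (hcc a).aestronglyMeasurable).add
        ((aestronglyMeasurable_of_continuousOn_compl_zero hq.continuousOn).mul
          (hcc b).aestronglyMeasurable))
    · filter_upwards [eventually_gt_atTop 0] with k hk
      filter_upwards [ae_ne_zero (μ := μ)] with y hy
      have hb (h : E → ℝ) (c : E) : |h y * fderiv ℝ (annularCutoff η k) y c|
          ≤ |h y * ‖y‖⁻¹| * (M * ‖c‖) := by
        have h1 := (fderiv ℝ (annularCutoff η k) y).le_of_opNorm_le (hM k hk y hy) c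
        rw [abs_mul, abs_mul, abs_of_nonneg (inv_nonneg.2 (norm_nonneg y))]
        calc |h y| * |fderiv ℝ (annularCutoff η k) y c|
            ≤ |h y| * (M * ‖y‖⁻¹ * ‖c‖) := by gcongr; exact h1
          _ = _ := by ring
      refine (norm_add_le _ _).trans (add_le_add ?_ ((norm_add_le _ _).trans
        (add_le_add (hb p a) (hb q b))))
      rw [norm_mul, Real.norm_eq_abs, Real.norm_eq_abs]
      exact mul_le_of_le_one_left (abs_nonneg _) (abs_annularCutoff_le η k y)
    · exact hi.abs.add ((hpi.abs.mul_const _).add (hqi.abs.mul_const _))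
    · filter_upwards [ae_ne_zero (μ := μ)] with y hy
      have hf (c : E) : Tendsto (fun k => fderiv ℝ (annularCutoff η k) y c) atTop (𝓝 0) := by
        have := ((ContinuousLinearMap.apply ℝ ℝ c).continuous.tendsto 0).comp
          (tendsto_fderiv_annularCutoff η hy)
        rwa [map_zero] at this
      simpa using ((tendsto_annularCutoff η hy).mul_const (fderiv ℝ p y a + fderiv ℝ q y b)).add
        (((hf a).const_mul (p y)).add ((hf b).const_mul (q y)))
  refine tendsto_nhds_unique hlim (tendsto_const_nhds.congr' ?_)
  filter_upwards [eventually_gt_atTop 0] with k hk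
  exact (hzero k hk).symm

end PuncturedDivergence

section RegularizedKernel

variable {E : Type*} [NormedAddCommGroup E] [InnerProductSpace ℝ E]

/-- Up to a constant factor, the second derivative in the directions `a` and `b` of the
regularization `(‖y‖ ^ 2 + ε ^ 2) ^ (p + 1)` of the Newtonian kernel. -/
noncomputable def regKernel (p ε : ℝ) (a b y : E) : ℝ :=
  ⟪a, b⟫ * (‖y‖ ^ 2 + ε ^ 2) ^ p + 2 * p * (⟪a, y⟫ * ⟪b, y⟫) * (‖y‖ ^ 2 + ε ^ 2) ^ (p - 1)

theorem regKernel_comm (p ε : ℝ) (a b y : E) : regKernel p ε a b y = regKernel p ε b a y := by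
  rw [regKernel, regKernel, real_inner_comm b a, mul_comm ⟪a, y⟫]

omit [InnerProductSpace ℝ E] in
theorem norm_sq_add_sq_pos {ε : ℝ} (hε : 0 < ε) (y : E) : 0 < ‖y‖ ^ 2 + ε ^ 2 := by positivity

theorem contDiff_regKernel {p ε : ℝ} (hε : 0 < ε) (a b : E) :
    ContDiff ℝ 1 (regKernel p ε a b) := by
  have h (q : ℝ) : ContDiff ℝ 1 fun y : E => (‖y‖ ^ 2 + ε ^ 2) ^ q :=
    ((contDiff_norm_sq ℝ).add contDiff_const).rpow_const_of_ne
      fun y => (norm_sq_add_sq_pos hε y).ne'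
  have hi (c : E) : ContDiff ℝ 1 fun y : E => ⟪c, y⟫ := contDiff_const.inner ℝ contDiff_id
  exact (contDiff_const.mul (h p)).add ((contDiff_const.mul ((hi a).mul (hi b))).mul (h (p - 1)))

theorem fderiv_regKernel_apply {p ε : ℝ} (hε : 0 < ε) (a b c y : E) :
    fderiv ℝ (regKernel p ε a b) y c =
      2 * p * (⟪a, b⟫ * ⟪c, y⟫ + ⟪b, c⟫ * ⟪a, y⟫ + ⟪a, c⟫ * ⟪b, y⟫) *
        (‖y‖ ^ 2 + ε ^ 2) ^ (p - 1) +
      4 * p * (p - 1) * (⟪a, y⟫ * ⟪b, y⟫ * ⟪c, y⟫) * (‖y‖ ^ 2 + ε ^ 2) ^ (p - 2) := by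
  have hline : HasDerivAt (fun t : ℝ => y + t • c) c 0 := by
    simpa using ((hasDerivAt_id (0 : ℝ)).smul_const c).const_add y
  have hi (e : E) : HasDerivAt (fun t : ℝ => ⟪e, y + t • c⟫) ⟪e, c⟫ 0 := by
    simpa using (hasDerivAt_const (0 : ℝ) e).inner ℝ hline
  have hs : HasDerivAt (fun t : ℝ => ‖y + t • c‖ ^ 2 + ε ^ 2) (2 * ⟪y, c⟫) 0 := by
    simpa using (hline.norm_sq).add_const (ε ^ 2)
  have hpos : ‖y + (0 : ℝ) • c‖ ^ 2 + ε ^ 2 ≠ 0 := (norm_sq_add_sq_pos hε _).ne'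
  have hr (q : ℝ) := hs.rpow_const (p := q) (Or.inl hpos)
  have h1 := ((hr p).const_mul ⟪a, b⟫).add ((((hi a).mul (hi b)).const_mul (2 * p)).mul (hr (p - 1)))
  have h2 : HasDerivAt (fun t : ℝ => regKernel p ε a b (y + t • c)) _ 0 :=
    ((contDiff_regKernel (p := p) hε a b).differentiable one_ne_zero y).hasFDerivAt.hasLineDerivAt c
  have h3 := HasDerivAt.unique h2 h1
  rw [h3]
  simp only [zero_smul, add_zero, Pi.mul_apply, real_inner_comm c y]
  rw [show p - 1 - 1 = p - 2 by ring]
  ring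

theorem fderiv_regKernel_comm {p ε : ℝ} (hε : 0 < ε) (a b c y : E) :
    fderiv ℝ (regKernel p ε a b) y c = fderiv ℝ (regKernel p ε a c) y b := by
  rw [fderiv_regKernel_apply hε, fderiv_regKernel_apply hε, real_inner_comm b c]
  ring

theorem abs_regKernel_le {p ε : ℝ} (a b : E) {y : E} (hs : 0 < ‖y‖ ^ 2 + ε ^ 2) :
    |regKernel p ε a b y| ≤ (1 + |2 * p|) * (‖a‖ * ‖b‖) * (‖y‖ ^ 2 + ε ^ 2) ^ p := by
  have h1 : |⟪a, b⟫| ≤ ‖a‖ * ‖b‖ := abs_real_inner_le_norm a b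
  have h2 : |⟪a, y⟫ * ⟪b, y⟫| ≤ ‖a‖ * ‖b‖ * (‖y‖ ^ 2 + ε ^ 2) := by
    rw [abs_mul]
    calc |⟪a, y⟫| * |⟪b, y⟫| ≤ (‖a‖ * ‖y‖) * (‖b‖ * ‖y‖) := by
          gcongr <;> exact abs_real_inner_le_norm _ _
      _ = ‖a‖ * ‖b‖ * ‖y‖ ^ 2 := by ring
      _ ≤ _ := by gcongr; exact le_add_of_nonneg_right (sq_nonneg _)
  have h3 : (‖y‖ ^ 2 + ε ^ 2) * (‖y‖ ^ 2 + ε ^ 2) ^ (p - 1) = (‖y‖ ^ 2 + ε ^ 2) ^ p := by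
    rw [Real.rpow_sub_one hs.ne']
    field_simp
  have h4 := Real.rpow_pos_of_pos hs p
  have h5 := Real.rpow_pos_of_pos hs (p - 1)
  calc |regKernel p ε a b y|
      ≤ |⟪a, b⟫| * (‖y‖ ^ 2 + ε ^ 2) ^ p +
        |2 * p| * |⟪a, y⟫ * ⟪b, y⟫| * (‖y‖ ^ 2 + ε ^ 2) ^ (p - 1) := by
        refine (abs_add_le _ _).trans_eq ?_
        rw [abs_mul, abs_mul (2 * p * _), abs_mul (2 * p), abs_of_pos h4, abs_of_pos h5]
    _ ≤ ‖a‖ * ‖b‖ * (‖y‖ ^ 2 + ε ^ 2) ^ p +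
        |2 * p| * (‖a‖ * ‖b‖ * (‖y‖ ^ 2 + ε ^ 2)) * (‖y‖ ^ 2 + ε ^ 2) ^ (p - 1) := by
        gcongr
    _ = _ := by rw [← h3]; ring

omit [InnerProductSpace ℝ E] in
theorem rpow_norm_sub_sq_add_sq_le {ε d : ℝ} (hε : 0 < ε) (hd : 0 ≤ d) (x y : E) :
    (‖y - x‖ ^ 2 + ε ^ 2) ^ (-(d / 2)) ≤
      ((1 + ‖x‖) / ε + 1) ^ d * (1 + ‖y‖) ^ (-d) := by
  set r := √(‖y - x‖ ^ 2 + ε ^ 2)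
  have hpos := norm_sq_add_sq_pos hε (y - x)
  have hr : 0 < r := Real.sqrt_pos.2 hpos
  have h1 : ‖y - x‖ ≤ r := Real.le_sqrt_of_sq_le (le_add_of_nonneg_right (sq_nonneg _))
  have h2 : ε ≤ r := Real.le_sqrt_of_sq_le (le_add_of_nonneg_left (sq_nonneg _))
  have h3 : 1 + ‖y‖ ≤ ((1 + ‖x‖) / ε + 1) * r := by
    have h4 : ‖y‖ ≤ ‖y - x‖ + ‖x‖ := by simpa using norm_add_le (y - x) x
    have h5 : 1 + ‖x‖ ≤ (1 + ‖x‖) / ε * r := by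
      calc 1 + ‖x‖ = (1 + ‖x‖) / ε * ε := by field_simp
        _ ≤ _ := by gcongr
    linarith
  have h6 : (‖y - x‖ ^ 2 + ε ^ 2) ^ (-(d / 2)) = r ^ (-d) := by
    rw [show ‖y - x‖ ^ 2 + ε ^ 2 = r ^ 2 from (Real.sq_sqrt hpos.le).symm,
      ← Real.rpow_natCast, ← Real.rpow_mul hr.le]
    congr 1
    push_cast
    ring
  have hc : 0 < (1 + ‖x‖) / ε + 1 := by positivity
  rw [h6, Real.rpow_neg hr.le, Real.rpow_neg (by positivity), ← div_eq_mul_inv,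
    le_div_iff₀ (by positivity), inv_mul_eq_div, div_le_iff₀ (by positivity),
    ← Real.mul_rpow hc.le hr.le]
  exact Real.rpow_le_rpow (by positivity) h3 hd

end RegularizedKernel

section SecondDerivative

variable {E : Type*} [NormedAddCommGroup E] [InnerProductSpace ℝ E] [FiniteDimensional ℝ E]
  [MeasurableSpace E] [BorelSpace E] {μ : Measure E} [μ.IsAddHaarMeasure]

theorem integrable_one_add_norm_rpow_mul_inv_norm (hd : 2 ≤ finrank ℝ E) :
    Integrable (fun y : E => (1 + ‖y‖) ^ (-(finrank ℝ E : ℝ)) * ‖y‖⁻¹) μ := by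
  have : Nontrivial E := Module.nontrivial_of_finrank_pos (R := ℝ) (by omega)
  have hmeas : AEStronglyMeasurable
      (fun y : E => (1 + ‖y‖) ^ (-(finrank ℝ E : ℝ)) * ‖y‖⁻¹) μ := by
    apply Measurable.aestronglyMeasurable
    fun_prop
  have hd' : (2 : ℝ) ≤ finrank ℝ E := by exact_mod_cast hd
  have h1 : IntegrableOn (fun y : E => (1 + ‖y‖) ^ (-(finrank ℝ E : ℝ)) * ‖y‖⁻¹) (ball 0 1) μ := by
    refine integrableOn_ball_of_norm_le_rpow (C := 1) (α := 1) (by omega) (by linarith)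
      (ae_of_all _ fun y => ?_) hmeas
    rw [Real.rpow_neg_one, norm_mul, norm_inv, norm_norm, Real.norm_of_nonneg (by positivity)]
    gcongr
    exact Real.rpow_le_one_of_one_le_of_nonpos (by simp) (by linarith)
  have h2 : IntegrableOn (fun y : E => (1 + ‖y‖) ^ (-(finrank ℝ E : ℝ)) * ‖y‖⁻¹)
      (ball 0 1)ᶜ μ := by
    refine Integrable.mono' (((integrable_one_add_norm (μ := μ)
      (lt_add_one (finrank ℝ E : ℝ))).const_mul 2).integrableOn) hmeas.restrict ?_
    refine (ae_restrict_iff' measurableSet_ball.compl).2 (ae_of_all _ fun y hy => ?_)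
    have hy : 1 ≤ ‖y‖ := by simpa using hy
    rw [norm_mul, norm_inv, norm_norm, Real.norm_of_nonneg (by positivity), neg_add,
      Real.rpow_add (by positivity), Real.rpow_neg_one]
    have : ‖y‖⁻¹ ≤ 2 * (1 + ‖y‖)⁻¹ := by
      rw [← div_eq_mul_inv, inv_eq_one_div, div_le_div_iff₀ (by positivity) (by positivity)]
      linarith
    calc _ ≤ (1 + ‖y‖) ^ (-(finrank ℝ E : ℝ)) * (2 * (1 + ‖y‖)⁻¹) := by gcongr
      _ = _ := by ring
  rw [← integrableOn_univ, ← union_compl_self (ball (0 : E) 1)]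
  exact h1.union h2

theorem integrable_regKernel_mul (hd : 2 ≤ finrank ℝ E) {ε : ℝ} (hε : 0 < ε) (x a b : E)
    {g : E → ℝ} (hg : ContinuousOn g {0}ᶜ) {M : ℝ} (hM : ∀ y ≠ 0, |g y| ≤ M * ‖y‖⁻¹) :
    Integrable (fun y => regKernel (-((finrank ℝ E : ℝ) / 2)) ε a b (y - x) * g y) μ := by
  have : Nontrivial E := Module.nontrivial_of_finrank_pos (R := ℝ) (by omega)
  set p := -((finrank ℝ E : ℝ) / 2)
  refine Integrable.mono' ((integrable_one_add_norm_rpow_mul_inv_norm (μ := μ) hd).const_mul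
    ((1 + |2 * p|) * (‖a‖ * ‖b‖) * ((1 + ‖x‖) / ε + 1) ^ (finrank ℝ E : ℝ) * M)) ?_ ?_
  · exact ((contDiff_regKernel hε a b).continuous.comp
      (continuous_sub_right x)).aestronglyMeasurable.mul
      (aestronglyMeasurable_of_continuousOn_compl_zero hg)
  · filter_upwards [ae_ne_zero (μ := μ)] with y hy
    have h1 := abs_regKernel_le (p := p) a b (norm_sq_add_sq_pos hε (y - x))
    have h2 := rpow_norm_sub_sq_add_sq_le hε (Nat.cast_nonneg (finrank ℝ E)) x y
    have h3 := hM y hy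
    rw [norm_mul, Real.norm_eq_abs, Real.norm_eq_abs]
    calc |regKernel p ε a b (y - x)| * |g y|
        ≤ ((1 + |2 * p|) * (‖a‖ * ‖b‖) * (((1 + ‖x‖) / ε + 1) ^ (finrank ℝ E : ℝ) *
          (1 + ‖y‖) ^ (-(finrank ℝ E : ℝ)))) * (M * ‖y‖⁻¹) := by
          refine mul_le_mul (h1.trans ?_) h3 (abs_nonneg _) (by positivity)
          gcongr
      _ = _ := by ring

/-- Moving the second derivatives from a function which is `C²` away from the origin to the
regularized kernel, one pair of directions at a time. -/
theorem integral_regKernel_mul_fderiv_fderiv (hd : 2 ≤ finrank ℝ E) {ε : ℝ} (hε : 0 < ε)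
    {v : E → ℝ} (hv : ContDiffOn ℝ 2 v {0}ᶜ) {M : ℝ} (hM1 : ∀ y ≠ 0, ‖fderiv ℝ v y‖ ≤ M)
    (hM2 : ∀ y ≠ 0, ‖fderiv ℝ (fderiv ℝ v) y‖ ≤ M * ‖y‖⁻¹) (x a b : E) :
    ∫ y, regKernel (-((finrank ℝ E : ℝ) / 2)) ε a a (y - x) * fderiv ℝ (fderiv ℝ v) y b b ∂μ =
      ∫ y, regKernel (-((finrank ℝ E : ℝ) / 2)) ε b b (y - x) *
        fderiv ℝ (fderiv ℝ v) y a a ∂μ := by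
  have : Nontrivial E := Module.nontrivial_of_finrank_pos (R := ℝ) (by omega)
  set p := -((finrank ℝ E : ℝ) / 2)
  have hv1 : ContDiffOn ℝ 1 (fderiv ℝ v) {0}ᶜ :=
    hv.fderiv_of_isOpen isOpen_compl_singleton (by norm_num)
  have hv2 : ContinuousOn (fderiv ℝ (fderiv ℝ v)) {0}ᶜ :=
    hv1.continuousOn_fderiv_of_isOpen isOpen_compl_singleton le_rfl
  have hmem {y : E} (hy : y ≠ 0) : ({0}ᶜ : Set E) ∈ 𝓝 y := isOpen_compl_singleton.mem_nhds hy
  have hD (c d : E) : ContinuousOn (fun y => fderiv ℝ (fderiv ℝ v) y c d) {0}ᶜ :=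
    (hv2.clm_apply continuousOn_const).clm_apply continuousOn_const
  have hDM (c d : E) (y : E) (hy : y ≠ 0) :
      |fderiv ℝ (fderiv ℝ v) y c d| ≤ M * ‖c‖ * ‖d‖ * ‖y‖⁻¹ := by
    have := (fderiv ℝ (fderiv ℝ v) y).le_of_opNorm₂_le_of_le (x := c) (y := d) (hM2 y hy)
      le_rfl le_rfl
    refine this.trans_eq ?_
    ring
  have hK (c d : E) : ContDiff ℝ 1 fun y => regKernel p ε c d (y - x) :=
    (contDiff_regKernel hε c d).comp (contDiff_id.sub contDiff_const)
  have hKd (c d e y : E) : fderiv ℝ (fun y => regKernel p ε c d (y - x)) y e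
      = fderiv ℝ (regKernel p ε c d) (y - x) e := by
    rw [fderiv_comp_sub]
  have hw (c : E) : ContDiffOn ℝ 1 (fun y => fderiv ℝ v y c) {0}ᶜ := hv1.clm_apply contDiffOn_const
  have hwd (c e : E) {y : E} (hy : y ≠ 0) :
      fderiv ℝ (fun y => fderiv ℝ v y c) y e = fderiv ℝ (fderiv ℝ v) y e c := by
    rw [fderiv_clm_apply ((hv1.contDiffAt (hmem hy)).differentiableAt one_ne_zero)
      (differentiableAt_const _)]
    simp
  have hprod (c d e : E) : ContDiffOn ℝ 1
      (fun y => regKernel p ε c d (y - x) * fderiv ℝ v y e) {0}ᶜ :=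
    (hK c d).contDiffOn.mul (hw e)
  have hprodd (c d e f : E) {y : E} (hy : y ≠ 0) :
      fderiv ℝ (fun y => regKernel p ε c d (y - x) * fderiv ℝ v y e) y f =
        regKernel p ε c d (y - x) * fderiv ℝ (fderiv ℝ v) y f e +
        fderiv ℝ v y e * fderiv ℝ (regKernel p ε c d) (y - x) f := by
    rw [fderiv_fun_mul ((hK c d).differentiable one_ne_zero y)
      (((hw e).contDiffAt (hmem hy)).differentiableAt one_ne_zero)]
    simp [hKd, hwd _ _ hy]
  have hprodi (c d e : E) : Integrable
      (fun y => regKernel p ε c d (y - x) * fderiv ℝ v y e * ‖y‖⁻¹) μ := by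
    simp only [mul_assoc]
    refine integrable_regKernel_mul hd hε x c d (M := M * ‖e‖)
      ((hw e).continuousOn.mul (continuousOn_id.norm.inv₀ fun y hy => norm_ne_zero_iff.2 hy))
      fun y hy => ?_
    rw [abs_mul, abs_of_nonneg (inv_nonneg.2 (norm_nonneg y))]
    gcongr
    exact (fderiv ℝ v y).le_of_opNorm_le (hM1 y hy) e
  have hi (c d e f : E) : Integrable
      (fun y => regKernel p ε c d (y - x) * fderiv ℝ (fderiv ℝ v) y e f) μ :=
    integrable_regKernel_mul hd hε x c d (hD e f) (hDM e f)
  have key (a b : E) : ∫ y, regKernel p ε a a (y - x) * fderiv ℝ (fderiv ℝ v) y b b ∂μ =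
      ∫ y, regKernel p ε a b (y - x) * fderiv ℝ (fderiv ℝ v) y a b ∂μ := by
    have hae : (fun y => regKernel p ε a a (y - x) * fderiv ℝ (fderiv ℝ v) y b b -
        regKernel p ε a b (y - x) * fderiv ℝ (fderiv ℝ v) y a b) =ᵐ[μ]
        fun y => fderiv ℝ (fun y => regKernel p ε a a (y - x) * fderiv ℝ v y b) y b +
          fderiv ℝ (fun y => regKernel p ε a b (y - x) * fderiv ℝ v y b) y (-a) := by
      filter_upwards [ae_ne_zero (μ := μ)] with y hy
      rw [hprodd _ _ _ _ hy, map_neg, hprodd _ _ _ _ hy, fderiv_regKernel_comm hε a a b]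
      ring
    have hint := (hi a a b b).sub (hi a b a b)
    have := integral_fderiv_add_fderiv_eq_zero (hprod a a b) (hprod a b b) (hprodi a a b)
      (hprodi a b b) (hint.congr hae)
    rw [← integral_congr_ae hae, integral_sub (hi a a b b) (hi a b a b), sub_eq_zero] at this
    exact this
  rw [key a b, key b a]
  refine integral_congr_ae ?_
  filter_upwards [ae_ne_zero (μ := μ)] with y hy
  rw [regKernel_comm, ((hv.contDiffAt (hmem hy)).isSymmSndFDerivAt (by simp)).eq a b]

end SecondDerivative

section Limit

variable {E : Type*} [NormedAddCommGroup E] [InnerProductSpace ℝ E] [FiniteDimensional ℝ E]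

omit [FiniteDimensional ℝ E] in
theorem sum_regKernel {ι : Type*} [Fintype ι] (e : OrthonormalBasis ι ℝ E) {ε : ℝ} (hε : 0 < ε)
    (y : E) :
    ∑ i, regKernel (-((finrank ℝ E : ℝ) / 2)) ε (e i) (e i) y =
      finrank ℝ E * (ε ^ 2 * (‖y‖ ^ 2 + ε ^ 2) ^ (-((finrank ℝ E : ℝ) / 2) - 1)) := by
  have hs := norm_sq_add_sq_pos hε y
  have h1 : ∑ i, ⟪e i, y⟫ * ⟪e i, y⟫ = ‖y‖ ^ 2 := by
    rw [← e.sum_sq_norm_inner_right y]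
    exact Finset.sum_congr rfl fun i _ => by rw [Real.norm_eq_abs, sq_abs, sq]
  have h2 : (Fintype.card ι : ℝ) = finrank ℝ E := by
    rw [Module.finrank_eq_card_basis e.toBasis]
  simp only [regKernel, Finset.sum_add_distrib, ← Finset.sum_mul, ← Finset.mul_sum, h1]
  simp only [inner_self_eq_norm_sq_to_K, e.norm_eq_one]
  simp only [RCLike.ofReal_real_eq_id, id, one_pow, Finset.sum_const, Finset.card_univ,
    nsmul_eq_mul, mul_one, h2]
  rw [Real.rpow_sub_one hs.ne']
  field_simp
  ring

variable [MeasurableSpace E] [BorelSpace E] {μ : Measure E} [μ.IsAddHaarMeasure]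

theorem hasDerivAt_pow_mul_one_add_sq_rpow {d : ℕ} (hd : 1 ≤ d) (r : ℝ) :
    HasDerivAt (fun r : ℝ => r ^ d * (1 + r ^ 2) ^ (-((d : ℝ) / 2)))
      (r ^ (d - 1) * (d * (1 + r ^ 2) ^ (-((d : ℝ) / 2) - 1))) r := by
  have hs : 0 < 1 + r ^ 2 := by positivity
  have h1 : HasDerivAt (fun r : ℝ => 1 + r ^ 2) (2 * r) r := by
    simpa using (hasDerivAt_pow 2 r).const_add 1
  refine ((hasDerivAt_pow d r).mul
    (h1.rpow_const (p := -((d : ℝ) / 2)) (Or.inl hs.ne'))).congr_deriv ?_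
  obtain ⟨k, rfl⟩ : ∃ k, d = k + 1 := ⟨d - 1, by omega⟩
  rw [Real.rpow_sub_one hs.ne', Nat.add_sub_cancel]
  field_simp
  ring

theorem tendsto_pow_mul_one_add_sq_rpow {d : ℕ} :
    Tendsto (fun r : ℝ => r ^ d * (1 + r ^ 2) ^ (-((d : ℝ) / 2))) atTop (𝓝 1) := by
  have h : Tendsto (fun r : ℝ => (1 + (r⁻¹) ^ 2) ^ (-((d : ℝ) / 2))) atTop (𝓝 1) := by
    have h1 : Tendsto (fun r : ℝ => 1 + (r⁻¹) ^ 2) atTop (𝓝 1) := by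
      simpa using (tendsto_inv_atTop_zero (𝕜 := ℝ)).pow 2 |>.const_add 1
    simpa using h1.rpow_const (p := -((d : ℝ) / 2)) (Or.inl one_ne_zero)
  refine h.congr' ?_
  filter_upwards [eventually_gt_atTop 0] with r hr
  have h2 : r ^ d = (r ^ 2) ^ ((d : ℝ) / 2) := by
    rw [← Real.rpow_natCast r 2, ← Real.rpow_mul hr.le, ← Real.rpow_natCast]
    congr 1
    push_cast
    ring
  rw [show 1 + r ^ 2 = r ^ 2 * (1 + (r⁻¹) ^ 2) by field_simp; ring,
    Real.mul_rpow (by positivity) (by positivity), Real.rpow_neg (by positivity) (_ / 2),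
    Real.rpow_neg (by positivity) (_ / 2), h2]
  field_simp

theorem integral_one_add_norm_sq_rpow (hd : 1 ≤ finrank ℝ E) :
    ∫ y : E, finrank ℝ E * (1 + ‖y‖ ^ 2) ^ (-((finrank ℝ E : ℝ) / 2) - 1) ∂μ =
      finrank ℝ E * μ.real (ball 0 1) := by
  have : Nontrivial E := Module.nontrivial_of_finrank_pos (R := ℝ) hd
  rw [integral_fun_norm_addHaar μ
    fun r : ℝ => (finrank ℝ E : ℝ) * (1 + r ^ 2) ^ (-((finrank ℝ E : ℝ) / 2) - 1)]
  simp only [smul_eq_mul, nsmul_eq_mul]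
  rw [integral_Ioi_of_hasDerivAt_of_nonneg' (fun r _ => hasDerivAt_pow_mul_one_add_sq_rpow hd r)
    (fun r hr => ?_) tendsto_pow_mul_one_add_sq_rpow]
  · simp [show finrank ℝ E ≠ 0 by omega]
  · have : 0 < r := hr
    positivity

theorem tendsto_integral_poisson_of_integrable (hd : 1 ≤ finrank ℝ E) {g : E → ℝ} {x : E}
    (hg : Integrable g μ) (hx : ContinuousAt g x) :
    Tendsto (fun c : ℝ => ∫ y, finrank ℝ E * ((c⁻¹) ^ 2 *
      (‖y - x‖ ^ 2 + (c⁻¹) ^ 2) ^ (-((finrank ℝ E : ℝ) / 2) - 1)) * g y ∂μ) atTop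
      (𝓝 (finrank ℝ E * μ.real (ball 0 1) * g x)) := by
  have hW : 0 < finrank ℝ E * μ.real (ball (0 : E) 1) := by
    have h1 : 0 < μ.real (ball (0 : E) 1) :=
      ENNReal.toReal_pos (measure_ball_pos μ 0 one_pos).ne' measure_ball_lt_top.ne
    have : (0 : ℝ) < finrank ℝ E := by exact_mod_cast hd
    positivity
  set W := finrank ℝ E * μ.real (ball (0 : E) 1)
  let φ : E → ℝ := fun y => W⁻¹ * (finrank ℝ E * (1 + ‖y‖ ^ 2) ^ (-((finrank ℝ E : ℝ) / 2) - 1))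
  have h1 := tendsto_integral_comp_smul_smul_of_integrable' (μ := μ) (φ := φ) (x₀ := x)
    (fun y => by positivity) ?_ ?_ hg hx
  · refine (h1.const_mul W).congr' ?_
    filter_upwards [eventually_gt_atTop 0] with c hc
    rw [← integral_const_mul]
    congr 1 with y
    have h2 : 1 + ‖c • (x - y)‖ ^ 2 = c ^ 2 * (‖y - x‖ ^ 2 + (c⁻¹) ^ 2) := by
      rw [norm_smul, norm_sub_rev, Real.norm_of_nonneg hc.le]
      field_simp
      ring
    have h3 : (c ^ 2) ^ (-((finrank ℝ E : ℝ) / 2) - 1) = (c ^ finrank ℝ E)⁻¹ * (c ^ 2)⁻¹ := by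
      rw [← Real.rpow_natCast c 2, ← Real.rpow_mul hc.le, ← Real.rpow_natCast,
        ← Real.rpow_neg hc.le, ← Real.rpow_neg hc.le, ← Real.rpow_add hc]
      congr 1
      push_cast
      ring
    simp only [φ, smul_eq_mul]
    rw [h2, Real.mul_rpow (by positivity) (by positivity), h3]
    field_simp
  · simp only [φ]
    rw [integral_const_mul, integral_one_add_norm_sq_rpow hd, inv_mul_cancel₀ hW.ne']
  · have h2 : Tendsto (fun y : E => W⁻¹ * finrank ℝ E * (‖y‖ ^ 2)⁻¹) (Bornology.cobounded E)
        (𝓝 0) := by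
      have := ((tendsto_pow_atTop two_ne_zero).comp
        (tendsto_norm_cobounded_atTop (E := E))).inv_tendsto_atTop.const_mul (W⁻¹ * finrank ℝ E)
      simpa using this
    refine squeeze_zero' (Eventually.of_forall fun y => by positivity) ?_ h2
    filter_upwards [tendsto_norm_cobounded_atTop.eventually_gt_atTop 0] with y hy
    have h3 : ‖y‖ ^ finrank ℝ E * (1 + ‖y‖ ^ 2) ^ (-((finrank ℝ E : ℝ) / 2) - 1) ≤
        (‖y‖ ^ 2)⁻¹ := by
      have h4 : (1 + ‖y‖ ^ 2) ^ (-((finrank ℝ E : ℝ) / 2) - 1) ≤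
          (‖y‖ ^ 2) ^ (-((finrank ℝ E : ℝ) / 2) - 1) := by
        refine Real.rpow_le_rpow_of_nonpos (by positivity) (by linarith) ?_
        have : (0 : ℝ) ≤ finrank ℝ E := by positivity
        linarith
      have h5 : (‖y‖ ^ 2) ^ (-((finrank ℝ E : ℝ) / 2) - 1) =
          (‖y‖ ^ finrank ℝ E)⁻¹ * (‖y‖ ^ 2)⁻¹ := by
        rw [← Real.rpow_natCast ‖y‖ 2, ← Real.rpow_mul hy.le, ← Real.rpow_natCast,
          ← Real.rpow_neg hy.le, ← Real.rpow_neg hy.le, ← Real.rpow_add hy]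
        congr 1
        push_cast
        ring
      calc _ ≤ ‖y‖ ^ finrank ℝ E * ((‖y‖ ^ finrank ℝ E)⁻¹ * (‖y‖ ^ 2)⁻¹) := by
            rw [← h5]
            gcongr
        _ = _ := by field_simp
    calc _ = W⁻¹ * finrank ℝ E * (‖y‖ ^ finrank ℝ E *
          (1 + ‖y‖ ^ 2) ^ (-((finrank ℝ E : ℝ) / 2) - 1)) := by simp only [φ]; ring
      _ ≤ _ := by gcongr

theorem tendsto_integral_poisson (hd : 2 ≤ finrank ℝ E) {g : E → ℝ} (hg : ContinuousOn g {0}ᶜ)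
    {M : ℝ} (hM : ∀ y ≠ 0, |g y| ≤ M * ‖y‖⁻¹) {x : E} (hx : x ≠ 0) :
    Tendsto (fun c : ℝ => ∫ y, finrank ℝ E * ((c⁻¹) ^ 2 *
      (‖y - x‖ ^ 2 + (c⁻¹) ^ 2) ^ (-((finrank ℝ E : ℝ) / 2) - 1)) * g y ∂μ) atTop
      (𝓝 (finrank ℝ E * μ.real (ball 0 1) * g x)) := by
  have : Nontrivial E := Module.nontrivial_of_finrank_pos (R := ℝ) (by omega)
  set p := -((finrank ℝ E : ℝ) / 2)
  have hx' : 0 < ‖x‖ := norm_pos_iff.2 hx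
  have hgm : AEStronglyMeasurable g μ := aestronglyMeasurable_of_continuousOn_compl_zero hg
  set ρ := ‖x‖ / 2
  have hρ : 0 < ρ := half_pos hx'
  set φ : ℝ → E → ℝ := fun c y =>
    finrank ℝ E * ((c⁻¹) ^ 2 * (‖y - x‖ ^ 2 + (c⁻¹) ^ 2) ^ (p - 1))
  have hφc {c : ℝ} (hc : 0 < c) : Continuous (φ c) := by
    refine continuous_const.mul (continuous_const.mul (Continuous.rpow_const ?_ fun y => Or.inl ?_))
    · exact ((continuous_sub_right x).norm.pow 2).add continuous_const
    · positivity
  have hφle {c : ℝ} (hc : 0 < c) (y : E) :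
      φ c y ≤ finrank ℝ E * (‖y - x‖ ^ 2 + (c⁻¹) ^ 2) ^ p := by
    have hs := norm_sq_add_sq_pos (inv_pos.2 hc) (y - x)
    simp only [φ]
    rw [Real.rpow_sub_one hs.ne', ← mul_div_assoc, mul_comm _ (_ ^ p), mul_div_assoc]
    gcongr
    refine mul_le_of_le_one_right (by positivity) ((div_le_one hs).2 ?_)
    exact le_add_of_nonneg_left (sq_nonneg _)
  have hφpos (c : ℝ) (y : E) : 0 ≤ φ c y := by positivity
  have hp : p ≤ 0 := neg_nonpos.2 (by positivity)
  have hφint {c : ℝ} (hc : 0 < c) : Integrable (fun y => φ c y * g y) μ := by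
    refine Integrable.mono' ((integrable_one_add_norm_rpow_mul_inv_norm (μ := μ) hd).const_mul
      (finrank ℝ E * ((1 + ‖x‖) / c⁻¹ + 1) ^ (finrank ℝ E : ℝ) * M))
      ((hφc hc).aestronglyMeasurable.mul hgm) ?_
    filter_upwards [ae_ne_zero (μ := μ)] with y hy
    rw [norm_mul, Real.norm_of_nonneg (hφpos c y), Real.norm_eq_abs]
    calc φ c y * |g y| ≤ finrank ℝ E * (((1 + ‖x‖) / c⁻¹ + 1) ^ (finrank ℝ E : ℝ) *
          (1 + ‖y‖) ^ (-(finrank ℝ E : ℝ))) * (M * ‖y‖⁻¹) := by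
          refine mul_le_mul ((hφle hc y).trans ?_) (hM y hy) (abs_nonneg _) (by positivity)
          gcongr
          exact rpow_norm_sub_sq_add_sq_le (inv_pos.2 hc) (by positivity) x y
      _ = _ := by ring
  have hnear : ∀ y ∈ ball x ρ, ρ ≤ ‖y‖ := by
    intro y hy
    rw [mem_ball, dist_eq_norm] at hy
    have := norm_sub_norm_le x y
    rw [norm_sub_rev] at this
    simp only [ρ] at *
    linarith
  have hin : Integrable ((ball x ρ).indicator g) μ := by
    rw [integrable_indicator_iff measurableSet_ball]
    refine Integrable.mono' (g := fun _ => M * ρ⁻¹)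
      (integrableOn_const measure_ball_lt_top.ne) hgm.restrict
      ((ae_restrict_iff' measurableSet_ball).2 (ae_of_all _ fun y hy => ?_))
    have h1 := hnear y hy
    have h2 : y ≠ 0 := norm_pos_iff.1 (hρ.trans_le h1)
    have hM0 : 0 ≤ M := nonneg_of_mul_nonneg_left ((abs_nonneg _).trans (hM x hx)) (by positivity)
    refine (hM y h2).trans ?_
    gcongr
  have hcont : ContinuousAt ((ball x ρ).indicator g) x := by
    have : (ball x ρ).indicator g =ᶠ[𝓝 x] g := by
      filter_upwards [ball_mem_nhds x hρ] with y hy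
      exact indicator_of_mem hy g
    exact (hg.continuousAt (isOpen_compl_singleton.mem_nhds hx)).congr this.symm
  have h1 := tendsto_integral_poisson_of_integrable (μ := μ) (by omega) hin hcont
  rw [indicator_of_mem (mem_ball_self hρ)] at h1
  have h2 : Tendsto (fun c => ∫ y, φ c y * (ball x ρ)ᶜ.indicator g y ∂μ) atTop (𝓝 0) := by
    rw [← integral_zero E ℝ (μ := μ)]
    refine tendsto_integral_filter_of_dominated_convergence (fun y => finrank ℝ E * (2 ^ (-p) *
      ((1 + ‖x‖) / ρ + 1) ^ (finrank ℝ E : ℝ)) * M *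
      ((1 + ‖y‖) ^ (-(finrank ℝ E : ℝ)) * ‖y‖⁻¹)) ?_ ?_ ?_ ?_
    · filter_upwards [eventually_gt_atTop 0] with c hc
      exact (hφc hc).aestronglyMeasurable.mul (hgm.indicator measurableSet_ball.compl)
    · filter_upwards [eventually_gt_atTop 0] with c hc
      filter_upwards [ae_ne_zero (μ := μ)] with y hy
      have hM0 : 0 ≤ M := nonneg_of_mul_nonneg_left ((abs_nonneg _).trans (hM x hx)) (by positivity)
      by_cases hyx : y ∈ (ball x ρ)ᶜ
      · rw [indicator_of_mem hyx, norm_mul, Real.norm_of_nonneg (hφpos c y), Real.norm_eq_abs]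
        have hyx : ρ ≤ ‖y - x‖ := by simpa [dist_eq_norm] using hyx
        have h3 : (‖y - x‖ ^ 2 + (c⁻¹) ^ 2) ^ p ≤ 2 ^ (-p) *
            (((1 + ‖x‖) / ρ + 1) ^ (finrank ℝ E : ℝ) * (1 + ‖y‖) ^ (-(finrank ℝ E : ℝ))) := by
          calc (‖y - x‖ ^ 2 + (c⁻¹) ^ 2) ^ p ≤ (2⁻¹ * (‖y - x‖ ^ 2 + ρ ^ 2)) ^ p := by
                refine Real.rpow_le_rpow_of_nonpos (by positivity) ?_ hp
                have : ρ ^ 2 ≤ ‖y - x‖ ^ 2 := by gcongr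
                have := sq_nonneg c⁻¹
                linarith
            _ = 2 ^ (-p) * (‖y - x‖ ^ 2 + ρ ^ 2) ^ p := by
                rw [Real.mul_rpow (by positivity) (by positivity), Real.inv_rpow (by positivity),
                  ← Real.rpow_neg (by positivity : (0 : ℝ) ≤ 2)]
            _ ≤ _ := by
                gcongr
                exact rpow_norm_sub_sq_add_sq_le hρ (by positivity) x y
        calc φ c y * |g y| ≤ finrank ℝ E * (2 ^ (-p) *
            (((1 + ‖x‖) / ρ + 1) ^ (finrank ℝ E : ℝ) * (1 + ‖y‖) ^ (-(finrank ℝ E : ℝ)))) *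
              (M * ‖y‖⁻¹) := by
              refine mul_le_mul ((hφle hc y).trans ?_) (hM y hy) (abs_nonneg _) (by positivity)
              gcongr
          _ = _ := by ring
      · rw [indicator_of_notMem hyx, mul_zero, norm_zero]
        positivity
    · exact (integrable_one_add_norm_rpow_mul_inv_norm hd).const_mul _
    · refine ae_of_all _ fun y => ?_
      by_cases hyx : y ∈ (ball x ρ)ᶜ
      · have hyx : ρ ≤ ‖y - x‖ := by simpa [dist_eq_norm] using hyx
        have hpos : ‖y - x‖ ^ 2 ≠ 0 := (pow_pos (hρ.trans_le hyx) 2).ne'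
        have h3 : Tendsto (fun c : ℝ => (c⁻¹) ^ 2) atTop (𝓝 0) := by
          simpa using (tendsto_inv_atTop_zero (𝕜 := ℝ)).pow 2
        have h4 : Tendsto (fun c : ℝ => (‖y - x‖ ^ 2 + (c⁻¹) ^ 2) ^ (p - 1)) atTop
            (𝓝 ((‖y - x‖ ^ 2) ^ (p - 1))) := by
          have := h3.const_add (‖y - x‖ ^ 2)
          rw [add_zero] at this
          exact this.rpow_const (Or.inl hpos)
        simpa [φ] using ((h3.mul h4).const_mul (finrank ℝ E : ℝ)).mul_const
          ((ball x ρ)ᶜ.indicator g y)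
      · simp [indicator_of_notMem hyx]
  have h3 := h1.add h2
  rw [add_zero] at h3
  refine h3.congr' ?_
  filter_upwards [eventually_gt_atTop 0] with c hc
  have hi (s : Set E) (hs : MeasurableSet s) : Integrable (fun y => φ c y * s.indicator g y) μ := by
    have := (hφint hc).indicator hs
    refine this.congr (ae_of_all _ fun y => ?_)
    by_cases hy : y ∈ s <;> simp [hy]
  rw [← integral_add (hi _ measurableSet_ball) (hi _ measurableSet_ball.compl)]
  congr 1 with y
  rw [← mul_add, ← Pi.add_apply ((ball x ρ).indicator g), indicator_self_add_compl]

theorem tendsto_integral_regKernel {x ξ : E} {p : ℝ} (hp : p ≤ 0) [Nontrivial E] {g : E → ℝ}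
    (hg : AEStronglyMeasurable g μ) (hi : Integrable (fun y => (‖y - x‖ ^ 2) ^ p * g y) μ) :
    Tendsto (fun c : ℝ => ∫ y, regKernel p c⁻¹ ξ ξ (y - x) * g y ∂μ) atTop
      (𝓝 (∫ y, regKernel p 0 ξ ξ (y - x) * g y ∂μ)) := by
  have hne : ∀ᵐ y ∂μ, y ≠ x := compl_mem_ae_iff.2 (measure_singleton _)
  refine tendsto_integral_filter_of_dominated_convergence
    (fun y => (1 + |2 * p|) * (‖ξ‖ * ‖ξ‖) * ‖(‖y - x‖ ^ 2) ^ p * g y‖) ?_ ?_ ?_ ?_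
  · filter_upwards [eventually_gt_atTop 0] with c hc
    exact ((contDiff_regKernel (inv_pos.2 hc) ξ ξ).continuous.comp
      (continuous_sub_right x)).aestronglyMeasurable.mul hg
  · filter_upwards [eventually_gt_atTop 0] with c hc
    filter_upwards [hne] with y hy
    have hy' : 0 < ‖y - x‖ := norm_pos_iff.2 (sub_ne_zero.2 hy)
    have h1 := abs_regKernel_le (p := p) ξ ξ (norm_sq_add_sq_pos (inv_pos.2 hc) (y - x))
    have h2 : (‖y - x‖ ^ 2 + (c⁻¹) ^ 2) ^ p ≤ (‖y - x‖ ^ 2) ^ p :=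
      Real.rpow_le_rpow_of_nonpos (by positivity) (le_add_of_nonneg_right (sq_nonneg _)) hp
    rw [norm_mul, norm_mul, Real.norm_of_nonneg (by positivity : 0 ≤ (‖y - x‖ ^ 2) ^ p), ← mul_assoc]
    gcongr
    refine h1.trans ?_
    gcongr
  · exact hi.norm.const_mul _
  · filter_upwards [hne] with y hy
    have hy' : 0 < ‖y - x‖ := norm_pos_iff.2 (sub_ne_zero.2 hy)
    have h3 : Tendsto (fun c : ℝ => ‖y - x‖ ^ 2 + (c⁻¹) ^ 2) atTop (𝓝 (‖y - x‖ ^ 2 + 0 ^ 2)) :=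
      ((tendsto_inv_atTop_zero (𝕜 := ℝ)).pow 2).const_add _
    have h4 (q : ℝ) := h3.rpow_const (p := q) (Or.inl (by positivity))
    exact (((h4 p).const_mul _).add ((h4 (p - 1)).const_mul _)).mul_const _

/-- A second derivative of `v` at `x` is a singular integral of the Laplacian of `v`, when the
latter is integrable against the singularity of the kernel at `x`. -/
theorem integral_regKernel_zero_mul_sum (hd : 2 ≤ finrank ℝ E) {ι : Type*} [Fintype ι]
    (e : OrthonormalBasis ι ℝ E) {v : E → ℝ} (hv : ContDiffOn ℝ 2 v {0}ᶜ) {M : ℝ}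
    (hM1 : ∀ y ≠ 0, ‖fderiv ℝ v y‖ ≤ M) (hM2 : ∀ y ≠ 0, ‖fderiv ℝ (fderiv ℝ v) y‖ ≤ M * ‖y‖⁻¹)
    {x : E} (hx : x ≠ 0) (ξ : E)
    (hi : Integrable (fun y => (‖y - x‖ ^ 2) ^ (-((finrank ℝ E : ℝ) / 2)) *
      ∑ i, fderiv ℝ (fderiv ℝ v) y (e i) (e i)) μ) :
    ∫ y, regKernel (-((finrank ℝ E : ℝ) / 2)) 0 ξ ξ (y - x) *
      ∑ i, fderiv ℝ (fderiv ℝ v) y (e i) (e i) ∂μ =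
      finrank ℝ E * μ.real (ball 0 1) * fderiv ℝ (fderiv ℝ v) x ξ ξ := by
  have : Nontrivial E := Module.nontrivial_of_finrank_pos (R := ℝ) (by omega)
  have hv2 : ContinuousOn (fderiv ℝ (fderiv ℝ v)) {0}ᶜ :=
    (hv.fderiv_of_isOpen (m := 1) isOpen_compl_singleton (by norm_num)).continuousOn_fderiv_of_isOpen
      isOpen_compl_singleton le_rfl
  have hD (c : E) : ContinuousOn (fun y => fderiv ℝ (fderiv ℝ v) y c c) {0}ᶜ :=
    (hv2.clm_apply continuousOn_const).clm_apply continuousOn_const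
  have hDM (c : E) (y : E) (hy : y ≠ 0) :
      |fderiv ℝ (fderiv ℝ v) y c c| ≤ M * ‖c‖ * ‖c‖ * ‖y‖⁻¹ := by
    have := (fderiv ℝ (fderiv ℝ v) y).le_of_opNorm₂_le_of_le (x := c) (y := c) (hM2 y hy)
      le_rfl le_rfl
    refine this.trans_eq ?_
    ring
  have h1 := tendsto_integral_regKernel (ξ := ξ) (neg_nonpos.2 (by positivity))
    (aestronglyMeasurable_of_continuousOn_compl_zero
      (continuousOn_finsetSum _ fun i _ => hD (e i))) hi
  have h2 := tendsto_integral_poisson (μ := μ) hd (hD ξ) (hDM ξ) hx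
  refine tendsto_nhds_unique (h1.congr' ?_) h2
  filter_upwards [eventually_gt_atTop 0] with c hc
  have hc' := inv_pos.2 hc
  simp only [Finset.mul_sum]
  rw [integral_finsetSum _ fun i _ =>
      integrable_regKernel_mul hd hc' x ξ ξ (hD (e i)) (hDM (e i)),
    Finset.sum_congr rfl fun i _ =>
      integral_regKernel_mul_fderiv_fderiv hd hc' hv hM1 hM2 x ξ (e i),
    ← integral_finsetSum _ fun i _ =>
      integrable_regKernel_mul hd hc' x (e i) (e i) (hD ξ) (hDM ξ)]
  simp only [← Finset.sum_mul, sum_regKernel e hc']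

end Limit

section Homogeneous

variable {E : Type*} [NormedAddCommGroup E] [NormedSpace ℝ E] {u : E → ℝ}

theorem fderiv_smul_of_homogeneous (hu : ∀ t : ℝ, 0 < t → ∀ y ≠ 0, u (t • y) = t * u y)
    {t : ℝ} (ht : 0 < t) {y : E} (hy : y ≠ 0) : fderiv ℝ u (t • y) = fderiv ℝ u y := by
  have h1 : (fun z => u (t • z)) =ᶠ[𝓝 y] t • u := by
    filter_upwards [isOpen_compl_singleton.mem_nhds hy] with z hz
    simpa using hu t ht z hz
  have h2 := h1.fderiv_eq (𝕜 := ℝ)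
  rw [fderiv_comp_smul, fderiv_const_smul_field] at h2
  exact smul_right_injective _ ht.ne' h2

theorem fderiv_fderiv_smul_of_homogeneous
    (hu : ∀ t : ℝ, 0 < t → ∀ y ≠ 0, u (t • y) = t * u y)
    {t : ℝ} (ht : 0 < t) {y : E} (hy : y ≠ 0) :
    fderiv ℝ (fderiv ℝ u) (t • y) = t⁻¹ • fderiv ℝ (fderiv ℝ u) y := by
  have h1 : (fun z => fderiv ℝ u (t • z)) =ᶠ[𝓝 y] fderiv ℝ u := by
    filter_upwards [isOpen_compl_singleton.mem_nhds hy] with z hz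
    exact fderiv_smul_of_homogeneous hu ht hz
  have h2 := h1.fderiv_eq (𝕜 := ℝ)
  rw [fderiv_comp_smul] at h2
  rw [← h2, inv_smul_smul₀ ht.ne']

theorem differentiableAt_fderiv_of_contDiffOn (h : ContDiffOn ℝ 2 u {0}ᶜ) {y : E} (hy : y ≠ 0) :
    DifferentiableAt ℝ (fderiv ℝ u) y :=
  ((h.contDiffAt (isOpen_compl_singleton.mem_nhds hy)).fderiv_right (m := 1)
    (by norm_num)).differentiableAt (by norm_num)

theorem fderiv_fderiv_apply_self_of_homogeneous
    (hu : ∀ t : ℝ, 0 < t → ∀ y ≠ 0, u (t • y) = t * u y) (h : ContDiffOn ℝ 2 u {0}ᶜ)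
    {y : E} (hy : y ≠ 0) : fderiv ℝ (fderiv ℝ u) y y = 0 := by
  have h1 : HasDerivAt (fun t : ℝ => t • y) y 1 := by
    simpa using (hasDerivAt_id (1 : ℝ)).smul_const y
  have h0 : DifferentiableAt ℝ (fderiv ℝ u) ((1 : ℝ) • y) := by
    rw [one_smul]
    exact differentiableAt_fderiv_of_contDiffOn h hy
  have h2 := h0.hasFDerivAt.comp_hasDerivAt (1 : ℝ) h1
  have h3 : (fderiv ℝ u ∘ fun t : ℝ => t • y) =ᶠ[𝓝 1] fun _ => fderiv ℝ u y := by
    filter_upwards [eventually_gt_nhds zero_lt_one] with t ht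
    exact fderiv_smul_of_homogeneous hu ht hy
  have h4 := (h2.congr_of_eventuallyEq h3.symm).unique (hasDerivAt_const _ _)
  rwa [one_smul] at h4

theorem fderiv_fderiv_apply_comm (h : ContDiffOn ℝ 2 u {0}ᶜ) {y : E} (hy : y ≠ 0) (a b : E) :
    fderiv ℝ (fderiv ℝ u) y a b = fderiv ℝ (fderiv ℝ u) y b a :=
  ((h.contDiffAt (isOpen_compl_singleton.mem_nhds hy)).isSymmSndFDerivAt (by simp)) a b

theorem exists_forall_norm_fderiv_le_of_homogeneous [FiniteDimensional ℝ E]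
    (hu : ∀ t : ℝ, 0 < t → ∀ y ≠ 0, u (t • y) = t * u y) (h : ContDiffOn ℝ 2 u {0}ᶜ) :
    ∃ M, (∀ y ≠ 0, ‖fderiv ℝ u y‖ ≤ M) ∧
      ∀ y ≠ 0, ‖fderiv ℝ (fderiv ℝ u) y‖ ≤ M * ‖y‖⁻¹ := by
  have : ProperSpace E := FiniteDimensional.proper_real E
  have hs : sphere (0 : E) 1 ⊆ {0}ᶜ := fun y hy h0 => by simp [mem_singleton_iff.1 h0] at hy
  have hu1 := h.fderiv_of_isOpen (m := 1) isOpen_compl_singleton (by norm_num)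
  have hu2 := hu1.continuousOn_fderiv_of_isOpen isOpen_compl_singleton le_rfl
  obtain ⟨M₁, hM₁⟩ := (isCompact_sphere (0 : E) 1).exists_bound_of_continuousOn
    (hu1.continuousOn.mono hs)
  obtain ⟨M₂, hM₂⟩ := (isCompact_sphere (0 : E) 1).exists_bound_of_continuousOn (hu2.mono hs)
  have hn (y : E) (hy : y ≠ 0) : ‖y‖⁻¹ • y ∈ sphere (0 : E) 1 := by
    simp [norm_smul, hy]
  refine ⟨max M₁ M₂, fun y hy => ?_, fun y hy => ?_⟩
  · rw [← fderiv_smul_of_homogeneous hu (inv_pos.2 (norm_pos_iff.2 hy)) hy]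
    exact (hM₁ _ (hn y hy)).trans (le_max_left _ _)
  · have h1 := fderiv_fderiv_smul_of_homogeneous hu (norm_pos_iff.2 hy) (hs (hn y hy))
    rw [smul_inv_smul₀ (norm_ne_zero_iff.2 hy)] at h1
    rw [h1]
    refine (ContinuousLinearMap.opNorm_smul_le _ _).trans ?_
    rw [norm_inv, norm_norm, mul_comm]
    gcongr
    exact (hM₂ _ (hn y hy)).trans (le_max_right _ _)

end Homogeneous

section Norm

variable {E : Type*} [NormedAddCommGroup E] [InnerProductSpace ℝ E]

theorem hasFDerivAt_norm_of_ne_zero {y : E} (hy : y ≠ 0) :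
    HasFDerivAt (fun z : E => ‖z‖) (‖y‖⁻¹ • innerSL ℝ y) y := by
  have h1 := (hasStrictFDerivAt_norm_sq y).hasFDerivAt.sqrt (pow_ne_zero 2 (norm_ne_zero_iff.2 hy))
  simp only [Real.sqrt_sq (norm_nonneg _)] at h1
  refine h1.congr_fderiv ?_
  ext z
  simp
  ring

theorem fderiv_fderiv_norm_apply {y : E} (hy : y ≠ 0) (a b : E) :
    fderiv ℝ (fderiv ℝ fun z : E => ‖z‖) y a b =
      ⟪a, b⟫ * ‖y‖⁻¹ - ⟪y, a⟫ * ⟪y, b⟫ * ‖y‖⁻¹ ^ 3 := by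
  have h1 : (fderiv ℝ fun z : E => ‖z‖) =ᶠ[𝓝 y] fun z => ‖z‖⁻¹ • innerSL ℝ z := by
    filter_upwards [isOpen_compl_singleton.mem_nhds hy] with z hz
    exact (hasFDerivAt_norm_of_ne_zero hz).fderiv
  have h2 : HasFDerivAt (fun z : E => ‖z‖⁻¹) _ y :=
    (hasDerivAt_inv (norm_ne_zero_iff.2 hy)).comp_hasFDerivAt y (hasFDerivAt_norm_of_ne_zero hy)
  have h3 : HasFDerivAt (fun z : E => ‖z‖⁻¹ • innerSL ℝ z) _ y :=
    h2.smul (innerSL ℝ (E := E)).hasFDerivAt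
  rw [h1.fderiv_eq, h3.fderiv]
  simp
  have := norm_ne_zero_iff.2 hy
  field_simp
  rw [innerSL_apply_apply]
  ring

theorem sum_fderiv_fderiv_norm_apply [FiniteDimensional ℝ E] {ι : Type*} [Fintype ι]
    (e : OrthonormalBasis ι ℝ E) {y : E} (hy : y ≠ 0) :
    ∑ i, fderiv ℝ (fderiv ℝ fun z : E => ‖z‖) y (e i) (e i) = (finrank ℝ E - 1) * ‖y‖⁻¹ := by
  have h1 : ∑ i, ⟪y, e i⟫ * ⟪y, e i⟫ = ‖y‖ ^ 2 := by
    rw [← e.sum_sq_norm_inner_left y]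
    exact Finset.sum_congr rfl fun i _ => by rw [Real.norm_eq_abs, sq_abs, sq]
  simp only [fderiv_fderiv_norm_apply hy, Finset.sum_sub_distrib, ← Finset.sum_mul, h1]
  have := norm_ne_zero_iff.2 hy
  simp [finrank_eq_card_basis e.toBasis]
  field_simp

theorem contDiffOn_norm_compl_zero {n : ℕ∞} : ContDiffOn ℝ n (fun z : E => ‖z‖) {0}ᶜ :=
  contDiffOn_id.norm ℝ fun _ hz => hz

theorem fderiv_fderiv_sub_mul_norm_apply {u : E → ℝ} (hu : ContDiffOn ℝ 2 u {0}ᶜ) (c : ℝ) {y : E}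
    (hy : y ≠ 0) (a b : E) :
    fderiv ℝ (fderiv ℝ fun z => u z - c * ‖z‖) y a b =
      fderiv ℝ (fderiv ℝ u) y a b - c * fderiv ℝ (fderiv ℝ fun z : E => ‖z‖) y a b := by
  have h1 : (fderiv ℝ fun z => u z - c * ‖z‖) =ᶠ[𝓝 y]
      fun z => fderiv ℝ u z - c • fderiv ℝ (fun z : E => ‖z‖) z := by
    filter_upwards [isOpen_compl_singleton.mem_nhds hy] with z hz
    have h2 : DifferentiableAt ℝ (fun z : E => ‖z‖) z :=
      (hasFDerivAt_norm_of_ne_zero hz).differentiableAt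
    rw [fderiv_fun_sub ((hu.contDiffAt (isOpen_compl_singleton.mem_nhds hz)).differentiableAt
      (by norm_num)) (h2.const_mul c), fderiv_const_mul h2]
  have h3 := differentiableAt_fderiv_of_contDiffOn (E := E) contDiffOn_norm_compl_zero hy
  have h4 : HasFDerivAt (fun z => fderiv ℝ u z - c • fderiv ℝ (fun z : E => ‖z‖) z) _ y :=
    (differentiableAt_fderiv_of_contDiffOn hu hy).hasFDerivAt.sub (h3.hasFDerivAt.const_smul c)
  rw [h1.fderiv_eq, h4.fderiv]
  rfl

end Norm

section Integrability

variable {E : Type*} [NormedAddCommGroup E] [InnerProductSpace ℝ E] [FiniteDimensional ℝ E]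
  [MeasurableSpace E] [BorelSpace E] {μ : Measure E} [μ.IsAddHaarMeasure]

theorem integrable_rpow_norm_sub_mul (hd : 2 ≤ finrank ℝ E) {g : E → ℝ}
    (hg : AEStronglyMeasurable g μ) {M B ρ α : ℝ} (hM : ∀ y ≠ 0, |g y| ≤ M * ‖y‖⁻¹) {x : E}
    (hρ : 0 < ρ) (hα : 0 < α) (hB : ∀ y ∈ ball x ρ, |g y| ≤ B * ‖y - x‖ ^ α) :
    Integrable (fun y => (‖y - x‖ ^ 2) ^ (-((finrank ℝ E : ℝ) / 2)) * g y) μ := by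
  have : Nontrivial E := Module.nontrivial_of_finrank_pos (R := ℝ) (by omega)
  have hsq (y : E) : (‖y - x‖ ^ 2) ^ (-((finrank ℝ E : ℝ) / 2)) =
      ‖y - x‖ ^ (-(finrank ℝ E : ℝ)) := by
    rw [← Real.rpow_natCast_mul (norm_nonneg _)]
    congr 1
    push_cast
    ring
  have hm : AEStronglyMeasurable
      (fun y => (‖y - x‖ ^ 2) ^ (-((finrank ℝ E : ℝ) / 2)) * g y) μ := by
    refine (Measurable.aestronglyMeasurable ?_).mul hg
    fun_prop
  rw [← integrableOn_univ, ← union_compl_self (ball x ρ), integrableOn_union]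
  constructor
  · have hm' : AEStronglyMeasurable
        (fun y => (‖(y + x) - x‖ ^ 2) ^ (-((finrank ℝ E : ℝ) / 2)) * g (y + x)) μ :=
      hm.comp_measurePreserving (measurePreserving_add_right μ x)
    have h1 := integrableOn_ball_of_norm_le_rpow (μ := μ) (r := ρ) (C := B) (by omega)
      (α := finrank ℝ E - α) (by linarith) ?_ hm'
    · have h2 := (measurePreserving_add_right μ x).integrableOn_comp_preimage
        (measurableEmbedding_addRight x) (s := ball x ρ)
        (f := fun y => (‖y - x‖ ^ 2) ^ (-((finrank ℝ E : ℝ) / 2)) * g y)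
      have h3 : (fun y => y + x) ⁻¹' ball x ρ = ball 0 ρ := by
        ext y
        simp [dist_eq_norm]
      rw [h3] at h2
      exact h2.1 h1
    · filter_upwards [ae_restrict_mem measurableSet_ball, ae_restrict_of_ae ae_ne_zero] with y hy hy0
      have hy0 : 0 < ‖y‖ := norm_pos_iff.2 hy0
      have := hB (y + x) (by simpa using hy)
      rw [hsq, norm_mul, Real.norm_of_nonneg (by positivity), Real.norm_eq_abs]
      rw [add_sub_cancel_right] at *
      calc ‖y‖ ^ (-(finrank ℝ E : ℝ)) * |g (y + x)| ≤
          ‖y‖ ^ (-(finrank ℝ E : ℝ)) * (B * ‖y‖ ^ α) := by gcongr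
        _ = B * ‖y‖ ^ (-(finrank ℝ E - α)) := by
          rw [mul_left_comm, ← Real.rpow_add hy0]
          congr 2
          ring
  · refine Integrable.mono' (((integrable_one_add_norm_rpow_mul_inv_norm (μ := μ) hd).const_mul
      (2 ^ ((finrank ℝ E : ℝ) / 2) * ((1 + ‖x‖) / ρ + 1) ^ (finrank ℝ E : ℝ) * M)).integrableOn)
      hm.restrict ?_
    filter_upwards [ae_restrict_mem measurableSet_ball.compl, ae_restrict_of_ae ae_ne_zero]
      with y hy hy0
    have hyx : ρ ≤ ‖y - x‖ := by simpa [dist_eq_norm] using hy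
    have h3 : (‖y - x‖ ^ 2) ^ (-((finrank ℝ E : ℝ) / 2)) ≤ 2 ^ ((finrank ℝ E : ℝ) / 2) *
        (((1 + ‖x‖) / ρ + 1) ^ (finrank ℝ E : ℝ) * (1 + ‖y‖) ^ (-(finrank ℝ E : ℝ))) := by
      calc (‖y - x‖ ^ 2) ^ (-((finrank ℝ E : ℝ) / 2))
          ≤ (2⁻¹ * (‖y - x‖ ^ 2 + ρ ^ 2)) ^ (-((finrank ℝ E : ℝ) / 2)) := by
            refine Real.rpow_le_rpow_of_nonpos (by positivity) ?_ (neg_nonpos.2 (by positivity))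
            have : ρ ^ 2 ≤ ‖y - x‖ ^ 2 := by gcongr
            linarith
        _ = 2 ^ ((finrank ℝ E : ℝ) / 2) *
            (‖y - x‖ ^ 2 + ρ ^ 2) ^ (-((finrank ℝ E : ℝ) / 2)) := by
            rw [Real.mul_rpow (by positivity) (by positivity), Real.inv_rpow (by positivity),
              ← Real.rpow_neg (by positivity : (0 : ℝ) ≤ 2), neg_neg]
        _ ≤ _ := by
            gcongr
            exact rpow_norm_sub_sq_add_sq_le hρ (by positivity) x y
    rw [norm_mul, Real.norm_of_nonneg (by positivity), Real.norm_eq_abs]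
    calc (‖y - x‖ ^ 2) ^ (-((finrank ℝ E : ℝ) / 2)) * |g y| ≤ 2 ^ ((finrank ℝ E : ℝ) / 2) *
        (((1 + ‖x‖) / ρ + 1) ^ (finrank ℝ E : ℝ) * (1 + ‖y‖) ^ (-(finrank ℝ E : ℝ))) *
          (M * ‖y‖⁻¹) := mul_le_mul h3 (hM y hy0) (abs_nonneg _) (by positivity)
      _ = _ := by ring

/-- Integration in polar coordinates. -/
theorem integral_eq_integral_toSphere [Nontrivial E] {h : E → ℝ} (hi : Integrable h μ) :
    Integrable (fun z : sphere (0 : E) 1 =>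
      ∫ r in Ioi (0 : ℝ), r ^ (finrank ℝ E - 1) * h (r • z)) μ.toSphere ∧
    ∫ z : sphere (0 : E) 1, (∫ r in Ioi (0 : ℝ), r ^ (finrank ℝ E - 1) * h (r • z)) ∂μ.toSphere =
      ∫ y, h y ∂μ := by
  set ν := Measure.volumeIoiPow (finrank ℝ E - 1)
  have hray (k : ℝ → ℝ) : ∫ r : Ioi (0 : ℝ), k r ∂ν =
      ∫ r in Ioi (0 : ℝ), r ^ (finrank ℝ E - 1) * k r := by
    simp only [ν, Measure.volumeIoiPow]
    rw [integral_withDensity_eq_integral_toReal_smul (by fun_prop) (by simp),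
      ← integral_subtype_comap measurableSet_Ioi fun r : ℝ => r ^ (finrank ℝ E - 1) * k r]
    refine integral_congr_ae (ae_of_all _ fun r => ?_)
    simp [ENNReal.toReal_ofReal (pow_nonneg (le_of_lt r.2) _)]
  have hmp := μ.measurePreserving_homeomorphUnitSphereProd
  have hemb := (homeomorphUnitSphereProd E).measurableEmbedding
  set H : sphere (0 : E) 1 × Ioi (0 : ℝ) → ℝ := fun q => h ((q.2 : ℝ) • (q.1 : E))
  have hH : H ∘ homeomorphUnitSphereProd E = fun y : ({0}ᶜ : Set E) => h y := by
    ext y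
    have := congr_arg Subtype.val ((homeomorphUnitSphereProd E).symm_apply_apply y)
    rw [homeomorphUnitSphereProd_symm_apply_coe] at this
    simp only [Function.comp_apply, H, this]
  have hHi : Integrable H (μ.toSphere.prod ν) := by
    rw [← hmp.integrable_comp_emb hemb, hH]
    have := hi.integrableOn (s := {0}ᶜ)
    rwa [integrableOn_iff_comap_subtypeVal (measurableSet_singleton _).compl] at this
  simp only [← hray]
  refine ⟨hHi.integral_prod_left, ?_⟩
  rw [← integral_prod (f := H) hHi, ← hmp.integral_comp hemb]
  have : ∀ y, H (homeomorphUnitSphereProd E y) = h y := fun y => congr_fun hH y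
  simp only [this]
  rw [integral_subtype_comap (measurableSet_singleton _).compl h, restrict_compl_singleton]

end Integrability

section SphericalKernel

variable {E : Type*} [NormedAddCommGroup E] [InnerProductSpace ℝ E]

theorem integrable_regKernel_zero_mul [MeasurableSpace E] [BorelSpace E]
    [SecondCountableTopology E] {μ : Measure E} [NullSingletonClass μ] {p : ℝ}
    {g : E → ℝ} (hg : AEStronglyMeasurable g μ) {x ξ : E}
    (hi : Integrable (fun y => (‖y - x‖ ^ 2) ^ p * g y) μ) :
    Integrable (fun y => regKernel p 0 ξ ξ (y - x) * g y) μ := by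
  have hne : ∀ᵐ y ∂μ, y ≠ x := compl_mem_ae_iff.2 (measure_singleton _)
  refine (hi.norm.const_mul ((1 + |2 * p|) * (‖ξ‖ * ‖ξ‖))).mono'
    (AEStronglyMeasurable.mul (Measurable.aestronglyMeasurable ?_) hg) ?_
  · unfold regKernel
    have (a : E) : Measurable fun y => ⟪a, y - x⟫ := by fun_prop
    fun_prop
  · filter_upwards [hne] with y hy
    have hy' : 0 < ‖y - x‖ := norm_pos_iff.2 (sub_ne_zero.2 hy)
    have h1 := abs_regKernel_le (p := p) (ε := 0) ξ ξ (y := y - x) (by positivity)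
    rw [norm_mul, norm_mul, Real.norm_of_nonneg (by positivity : 0 ≤ (‖y - x‖ ^ 2) ^ p), ← mul_assoc]
    gcongr
    refine h1.trans_eq ?_
    simp

theorem norm_inv_norm_smul_sub_le {x y : E} (hx : ‖x‖ = 1) (hy : y ≠ 0) :
    ‖‖y‖⁻¹ • y - x‖ ≤ 2 * ‖y - x‖ := by
  have hy' := norm_ne_zero_iff.2 hy
  have h1 : ‖‖y‖⁻¹ • y - y‖ = |‖x‖ - ‖y‖| := by
    have : ‖y‖⁻¹ • y - y = (‖y‖⁻¹ - 1) • y := by rw [sub_smul, one_smul]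
    rw [this, norm_smul, Real.norm_eq_abs, hx, ← abs_of_nonneg (norm_nonneg y), ← abs_mul,
      abs_of_nonneg (norm_nonneg y), sub_mul, inv_mul_cancel₀ hy', one_mul]
  have h2 := norm_sub_le_norm_sub_add_norm_sub (‖y‖⁻¹ • y) y x
  have h3 := abs_norm_sub_norm_le x y
  rw [norm_sub_rev x y] at h3
  linarith

theorem regKernel_zero_eq_div {n : ℕ} {x ξ z : E} (hξ : ‖ξ‖ = 1) (h : ⟪ξ, x⟫ = 0) (r : ℝ) :
    regKernel (-(((n + 1 : ℕ) : ℝ) / 2)) 0 ξ ξ (r • z - x) =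
      (‖x - r • z‖ ^ 2 - (n + 1) * ⟪ξ, r • z⟫ ^ 2) / ‖x - r • z‖ ^ (n + 3) := by
  have h1 : ⟪ξ, r • z - x⟫ = ⟪ξ, r • z⟫ := by rw [inner_sub_right, h, sub_zero]
  rw [norm_sub_rev x, regKernel, real_inner_self_eq_norm_sq, hξ, h1]
  rcases (norm_nonneg (r • z - x)).eq_or_lt with h0 | h0
  · have h2 : ⟪ξ, r • z⟫ = 0 := by
      rw [← h1, norm_eq_zero.1 h0.symm, inner_zero_right]
    rw [← h0, h2]
    have : -(((n + 1 : ℕ) : ℝ) / 2) ≠ 0 := neg_ne_zero.2 (by positivity)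
    rw [zero_pow two_ne_zero, add_zero, Real.zero_rpow this]
    simp
  · set w := ‖r • z - x‖
    have h2 (k : ℕ) : (w ^ 2) ^ (-((k : ℝ) / 2)) = (w ^ k)⁻¹ := by
      rw [← Real.rpow_natCast_mul h0.le, ← Real.rpow_natCast, ← Real.rpow_neg h0.le]
      congr 1
      push_cast
      ring
    have h3 : -(((n + 1 : ℕ) : ℝ) / 2) - 1 = -(((n + 3 : ℕ) : ℝ) / 2) := by
      push_cast
      ring
    rw [h3, zero_pow two_ne_zero, add_zero, h2, h2]
    push_cast
    field_simp
    ring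

end SphericalKernel

section Main

theorem laplacian_eq_sum {m : ℕ} {u : EuclideanSpace ℝ (Fin m) → ℝ}
    {x : EuclideanSpace ℝ (Fin m)} (h : DifferentiableAt ℝ (fderiv ℝ u) x) :
    laplacian u x = ∑ i, fderiv ℝ (fderiv ℝ u) x (EuclideanSpace.basisFun (Fin m) ℝ i)
      (EuclideanSpace.basisFun (Fin m) ℝ i) := by
  refine Finset.sum_congr rfl fun i _ => ?_
  rw [fderiv_clm_apply h (differentiableAt_const _)]
  simp

variable {n : ℕ} {α : ℝ} {f u : EuclideanSpace ℝ (Fin (n + 1)) → ℝ} {C : ℝ}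

/-- The second derivative of `u` at a point of the sphere in a tangential direction, as an integral
over the sphere against the kernel `omegaHat`. -/
theorem integral_omegaHat_mul_sub (hn : 2 ≤ n) (hα : 0 < α)
    (hf_hom : ∀ t : ℝ, 0 < t → ∀ y ≠ 0, f (t • y) = t⁻¹ * f y)
    (hu_hom : ∀ t : ℝ, 0 < t → ∀ y ≠ 0, u (t • y) = t * u y)
    (hu : ContDiffOn ℝ 2 u {0}ᶜ) (hu_lap : ∀ x ≠ 0, laplacian u x = f x)
    {x ξ : EuclideanSpace ℝ (Fin (n + 1))} (hx : ‖x‖ = 1) (hξ : ‖ξ‖ = 1) (h : ⟪ξ, x⟫ = 0)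
    (hf : ∀ z, ‖z‖ = 1 → |f z - f x| ≤ C * ‖z - x‖ ^ α) :
    Integrable (fun z : sphere (0 : EuclideanSpace ℝ (Fin (n + 1))) 1 =>
      omegaHat n x ξ z * (f z - f x)) (sphereMeasure n) ∧
    (∫ z : sphere (0 : EuclideanSpace ℝ (Fin (n + 1))) 1,
      omegaHat n x ξ z * (f z - f x) ∂(sphereMeasure n)) + f x / n =
      fderiv ℝ (fderiv ℝ u) x ξ ξ := by
  set e := EuclideanSpace.basisFun (Fin (n + 1)) ℝ
  have hfin : finrank ℝ (EuclideanSpace ℝ (Fin (n + 1))) = n + 1 := finrank_euclideanSpace_fin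
  have hn0 : (n : ℝ) ≠ 0 := by positivity
  have hx0 : x ≠ 0 := norm_ne_zero_iff.1 (by simp [hx])
  have hC : 0 ≤ C := by
    have := (abs_nonneg _).trans (hf (-x) (by simpa using hx))
    refine nonneg_of_mul_nonneg_left this (Real.rpow_pos_of_pos (norm_pos_iff.2 ?_) _)
    rw [← neg_add', neg_ne_zero, ← two_smul ℝ x]
    exact smul_ne_zero two_ne_zero hx0
  set c := f x / n
  set v : EuclideanSpace ℝ (Fin (n + 1)) → ℝ := fun y => u y - c * ‖y‖
  have hv : ContDiffOn ℝ 2 v {0}ᶜ :=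
    hu.sub (contDiffOn_const.mul (contDiffOn_norm_compl_zero (n := 2)))
  have hv_hom : ∀ t : ℝ, 0 < t → ∀ y ≠ 0, v (t • y) = t * v y := fun t ht y hy => by
    simp only [v, hu_hom t ht y hy, norm_smul, Real.norm_of_nonneg ht.le]
    ring
  obtain ⟨M, hM1, hM2⟩ := exists_forall_norm_fderiv_le_of_homogeneous hv_hom hv
  set g : EuclideanSpace ℝ (Fin (n + 1)) → ℝ := fun y =>
    ∑ i, fderiv ℝ (fderiv ℝ v) y (e i) (e i)
  have hg (y : EuclideanSpace ℝ (Fin (n + 1))) (hy : y ≠ 0) : g y = f y - f x * ‖y‖⁻¹ := by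
    simp only [g, v, fderiv_fderiv_sub_mul_norm_apply hu c hy, Finset.sum_sub_distrib,
      ← Finset.mul_sum, sum_fderiv_fderiv_norm_apply e hy, hfin]
    rw [← hu_lap y hy, laplacian_eq_sum (differentiableAt_fderiv_of_contDiffOn hu hy)]
    simp only [c]
    push_cast
    field_simp
    ring
  have hg' (y : EuclideanSpace ℝ (Fin (n + 1))) (hy : y ≠ 0) :
      g y = ‖y‖⁻¹ * (f (‖y‖⁻¹ • y) - f x) := by
    have := norm_ne_zero_iff.2 hy
    rw [hg y hy, hf_hom _ (inv_pos.2 (norm_pos_iff.2 hy)) y hy]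
    field_simp
  have hgm : AEStronglyMeasurable g volume := by
    have hv2 : ContinuousOn (fderiv ℝ (fderiv ℝ v)) {0}ᶜ :=
      (hv.fderiv_of_isOpen (m := 1) isOpen_compl_singleton
        (by norm_num)).continuousOn_fderiv_of_isOpen isOpen_compl_singleton le_rfl
    exact aestronglyMeasurable_of_continuousOn_compl_zero (continuousOn_finsetSum _ fun i _ =>
      (hv2.clm_apply continuousOn_const).clm_apply continuousOn_const)
  have hsph (y : EuclideanSpace ℝ (Fin (n + 1))) (hy : y ≠ 0) : ‖‖y‖⁻¹ • y‖ = 1 := by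
    simp [norm_smul, hy]
  have hgM (y : EuclideanSpace ℝ (Fin (n + 1))) (hy : y ≠ 0) :
      |g y| ≤ C * 2 ^ α * ‖y‖⁻¹ := by
    rw [hg' y hy, abs_mul, abs_inv, abs_norm, mul_comm]
    gcongr
    refine (hf _ (hsph y hy)).trans ?_
    gcongr
    refine (norm_sub_le _ _).trans_eq ?_
    rw [hsph y hy, hx]
    norm_num
  have hgB (y : EuclideanSpace ℝ (Fin (n + 1))) (hy : y ∈ ball x 2⁻¹) :
      |g y| ≤ 2 * (C * 2 ^ α) * ‖y - x‖ ^ α := by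
    rw [mem_ball, dist_eq_norm] at hy
    have h1 : 2⁻¹ ≤ ‖y‖ := by
      have := norm_sub_norm_le x y
      rw [norm_sub_rev] at this
      linarith
    have hy0 : y ≠ 0 := norm_pos_iff.1 (h1.trans_lt' (by norm_num))
    rw [hg' y hy0, abs_mul, abs_inv, abs_norm, mul_assoc]
    gcongr
    · exact inv_le_of_inv_le₀ (by norm_num) h1
    · refine (hf _ (hsph y hy0)).trans ?_
      rw [mul_assoc, ← Real.mul_rpow (by norm_num) (norm_nonneg _)]
      gcongr
      exact norm_inv_norm_smul_sub_le hx hy0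
  have hi := integrable_rpow_norm_sub_mul (μ := volume) (by omega) hgm hgM (by norm_num) hα hgB
  have hkey := integral_regKernel_zero_mul_sum (μ := volume) (by omega) e hv hM1 hM2 hx0 ξ hi
  obtain ⟨h1, h2⟩ := integral_eq_integral_toSphere (integrable_regKernel_zero_mul (ξ := ξ) hgm hi)
  have homega : omega_n n = (n + 1 : ℕ) *
      (volume : Measure (EuclideanSpace ℝ (Fin (n + 1)))).real (ball 0 1) := by
    rw [omega_n, sphereMeasure, ← measureReal_def, Measure.toSphere_real_apply_univ, hfin]
  have homega0 : omega_n n ≠ 0 := by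
    rw [homega]
    refine mul_ne_zero (by positivity) ?_
    exact (ENNReal.toReal_pos (measure_ball_pos _ _ one_pos).ne' measure_ball_lt_top.ne).ne'
  have hker (z : sphere (0 : EuclideanSpace ℝ (Fin (n + 1))) 1) :
      ∫ r in Ioi (0 : ℝ), r ^ (finrank ℝ (EuclideanSpace ℝ (Fin (n + 1))) - 1) *
        (regKernel (-((finrank ℝ (EuclideanSpace ℝ (Fin (n + 1))) : ℝ) / 2)) 0 ξ ξ
          (r • (z : EuclideanSpace ℝ (Fin (n + 1))) - x) * g (r • (z : EuclideanSpace ℝ (Fin (n + 1))))) =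
      omega_n n * (omegaHat n x ξ z * (f z - f x)) := by
    have hz : ‖(z : EuclideanSpace ℝ (Fin (n + 1)))‖ = 1 := norm_eq_of_mem_sphere z
    have hz0 : (z : EuclideanSpace ℝ (Fin (n + 1))) ≠ 0 := norm_ne_zero_iff.1 (by simp [hz])
    rw [omegaHat, mul_assoc, ← integral_mul_const, ← mul_assoc, mul_one_div_cancel homega0, one_mul]
    refine setIntegral_congr_fun measurableSet_Ioi fun r hr => ?_
    have hr : 0 < r := hr
    have hgr : g (r • (z : EuclideanSpace ℝ (Fin (n + 1)))) = r⁻¹ * (f z - f x) := by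
      rw [hg _ (smul_ne_zero hr.ne' hz0), hf_hom r hr _ hz0, norm_smul, hz,
        Real.norm_of_nonneg hr.le]
      ring
    have hrn : r ^ n = r ^ (n - 1) * r := by rw [← pow_succ, Nat.sub_add_cancel (by omega)]
    simp only [hfin, regKernel_zero_eq_div hξ h, hgr, Nat.add_sub_cancel, hrn]
    field_simp
  simp only [hker] at h1 h2
  rw [integral_const_mul, hkey, hfin, ← homega] at h2
  refine ⟨(integrable_const_mul_iff (isUnit_iff_ne_zero.2 homega0) _).1 h1, ?_⟩
  rw [sphereMeasure, mul_left_cancel₀ homega0 h2, fderiv_fderiv_sub_mul_norm_apply hu c hx0,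
    fderiv_fderiv_norm_apply hx0, real_inner_self_eq_norm_sq, hξ, hx, real_inner_comm, h]
  ring

end Main

section Convexity

variable {E : Type*} [NormedAddCommGroup E] [InnerProductSpace ℝ E] {u : E → ℝ}

theorem hasDerivAt_add_smul (a b : E) (t : ℝ) : HasDerivAt (fun t : ℝ => a + t • b) b t := by
  simpa using ((hasDerivAt_id t).smul_const b).const_add a

theorem hasDerivAt_comp_add_smul (hu : ContDiffOn ℝ 2 u {0}ᶜ) {a b : E} {t : ℝ}
    (h : a + t • b ≠ 0) :
    HasDerivAt (fun t : ℝ => u (a + t • b)) (fderiv ℝ u (a + t • b) b) t :=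
  ((hu.contDiffAt (isOpen_compl_singleton.mem_nhds h)).differentiableAt
    (by norm_num)).hasFDerivAt.comp_hasDerivAt t (hasDerivAt_add_smul a b t)

theorem hasDerivAt_fderiv_comp_add_smul (hu : ContDiffOn ℝ 2 u {0}ᶜ) {a b : E} {t : ℝ}
    (h : a + t • b ≠ 0) :
    HasDerivAt (fun t : ℝ => fderiv ℝ u (a + t • b) b)
      (fderiv ℝ (fderiv ℝ u) (a + t • b) b b) t := by
  have h1 := (differentiableAt_fderiv_of_contDiffOn hu h).hasFDerivAt.comp_hasDerivAt t
    (hasDerivAt_add_smul a b t)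
  exact ((ContinuousLinearMap.apply ℝ ℝ b).hasFDerivAt.comp_hasDerivAt t h1)

theorem fderiv_fderiv_nonneg_of_convexOn (hc : ConvexOn ℝ univ u) (hu : ContDiffOn ℝ 2 u {0}ᶜ)
    {x ξ : E} (hx : x ≠ 0) (h : ⟪ξ, x⟫ = 0) : 0 ≤ fderiv ℝ (fderiv ℝ u) x ξ ξ := by
  have hne (t : ℝ) : x + t • ξ ≠ 0 := fun h0 => by
    have := congr_arg (⟪·, x⟫) h0
    simp [inner_add_left, inner_smul_left, h, hx] at this
  have h1 (t : ℝ) := hasDerivAt_comp_add_smul hu (hne t)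
  have h2 : ConvexOn ℝ univ fun t : ℝ => u (x + t • ξ) := by
    have := hc.comp_affineMap (AffineMap.lineMap x (x + ξ) : ℝ →ᵃ[ℝ] E)
    rw [preimage_univ] at this
    refine this.congr fun t _ => ?_
    simp [AffineMap.lineMap_apply, add_comm]
  have h3 : Monotone (deriv fun t : ℝ => u (x + t • ξ)) := by
    rw [← monotoneOn_univ]
    exact h2.monotoneOn_deriv fun t _ => (h1 t).differentiableAt
  have h4 : (deriv fun t : ℝ => u (x + t • ξ)) = fun t => fderiv ℝ u (x + t • ξ) ξ :=
    funext fun t => (h1 t).deriv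
  have h5 := (hasDerivAt_fderiv_comp_add_smul hu (hne 0)).deriv
  rw [h4] at h3
  rw [zero_smul, add_zero] at h5
  rw [← h5]
  exact h3.deriv_nonneg

theorem fderiv_fderiv_nonneg_of_homogeneous
    (hom : ∀ t : ℝ, 0 < t → ∀ y ≠ 0, u (t • y) = t * u y) (hu : ContDiffOn ℝ 2 u {0}ᶜ)
    (h : ∀ x ξ : E, ‖x‖ = 1 → ‖ξ‖ = 1 → ⟪ξ, x⟫ = 0 → 0 ≤ fderiv ℝ (fderiv ℝ u) x ξ ξ)
    {y : E} (hy : y ≠ 0) (η : E) : 0 ≤ fderiv ℝ (fderiv ℝ u) y η η := by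
  have hy' : 0 < ‖y‖ := norm_pos_iff.2 hy
  set x := ‖y‖⁻¹ • y
  have hx : ‖x‖ = 1 := by simp [x, norm_smul, hy]
  have hx0 : x ≠ 0 := norm_ne_zero_iff.1 (by simp [hx])
  have hyx : y = ‖y‖ • x := (smul_inv_smul₀ hy'.ne' y).symm
  set c := ⟪x, η⟫
  set w := η - c • x
  have hw : ⟪w, x⟫ = 0 := by
    simp only [w, c, inner_sub_left, inner_smul_left, real_inner_self_eq_norm_sq, hx,
      real_inner_comm]
    simp
  have hη : η = w + c • x := (sub_add_cancel _ _).symm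
  have hE := fderiv_fderiv_apply_self_of_homogeneous hom hu hx0
  have hS : fderiv ℝ (fderiv ℝ u) x w x = 0 := by
    rw [fderiv_fderiv_apply_comm hu hx0, hE]
    rfl
  rw [hyx, fderiv_fderiv_smul_of_homogeneous hom hy' hx0]
  suffices 0 ≤ fderiv ℝ (fderiv ℝ u) x η η from mul_nonneg (inv_nonneg.2 hy'.le) this
  have h1 : fderiv ℝ (fderiv ℝ u) x η η = fderiv ℝ (fderiv ℝ u) x w w := by
    rw [hη]
    simp [hE, hS]
  rw [h1]
  rcases eq_or_ne w 0 with h0 | h0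
  · simp [h0]
  · have hw' : 0 < ‖w‖⁻¹ := inv_pos.2 (norm_pos_iff.2 h0)
    have h3 := h x (‖w‖⁻¹ • w) hx (by simp [norm_smul, h0]) (by rw [inner_smul_left, hw, mul_zero])
    simp only [map_smul, smul_apply, smul_eq_mul] at h3
    exact (mul_nonneg_iff_of_pos_left hw').1 ((mul_nonneg_iff_of_pos_left hw').1 h3)

theorem convexOn_univ_of_fderiv_fderiv_nonneg (hd : 2 < finrank ℝ E) (hcont : Continuous u)
    (hu : ContDiffOn ℝ 2 u {0}ᶜ) (h : ∀ y ≠ 0, ∀ η, 0 ≤ fderiv ℝ (fderiv ℝ u) y η η) :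
    ConvexOn ℝ univ u := by
  refine ⟨convex_univ, fun a _ b _ s t hs ht hst => ?_⟩
  obtain ⟨w, hw⟩ : ∃ w, w ∉ Submodule.span ℝ ({a, b} : Set E) := by
    by_contra! hall
    have h1 : Submodule.span ℝ ({a, b} : Set E) = ⊤ := Submodule.eq_top_iff'.2 hall
    classical
    have h2 := finrank_span_finset_le_card (R := ℝ) ({a, b} : Finset E)
    rw [Finset.coe_pair, Set.finrank, h1, finrank_top] at h2
    have := Finset.card_le_two (a := a) (b := b)
    omega
  have hδ : ∀ δ : ℝ, δ ≠ 0 →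
      u (s • a + t • b + δ • w) ≤ s * u (a + δ • w) + t * u (b + δ • w) := by
    intro δ hδ
    have hne (τ : ℝ) : (a + δ • w) + τ • (b - a) ≠ 0 := fun h0 => by
      refine hw ?_
      have h1 : w = δ⁻¹ • (τ • (a - b) - a) := by
        rw [eq_inv_smul_iff₀ hδ, ← sub_eq_zero, ← h0]
        module
      rw [h1]
      have ha : a ∈ Submodule.span ℝ ({a, b} : Set E) := Submodule.subset_span (by simp)
      have hb : b ∈ Submodule.span ℝ ({a, b} : Set E) := Submodule.subset_span (by simp)
      exact Submodule.smul_mem _ _ (sub_mem (Submodule.smul_mem _ _ (sub_mem ha hb)) ha)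
    have h1 (τ : ℝ) := hasDerivAt_comp_add_smul hu (hne τ)
    have h2 (τ : ℝ) := hasDerivAt_fderiv_comp_add_smul hu (hne τ)
    have h4 : (deriv fun τ : ℝ => u ((a + δ • w) + τ • (b - a))) =
        fun τ => fderiv ℝ u ((a + δ • w) + τ • (b - a)) (b - a) := funext fun τ => (h1 τ).deriv
    have h5 : ConvexOn ℝ univ fun τ : ℝ => u ((a + δ • w) + τ • (b - a)) := by
      refine convexOn_univ_of_deriv2_nonneg (fun τ => (h1 τ).differentiableAt) ?_ fun τ => ?_
      · rw [h4]
        exact fun τ => (h2 τ).differentiableAt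
      · rw [Function.iterate_succ_apply, Function.iterate_one, h4, (h2 τ).deriv]
        exact h _ (hne τ) _
    have h6 := h5.2 (mem_univ 0) (mem_univ 1) hs ht hst
    simp only [smul_eq_mul, mul_zero, mul_one, zero_add, zero_smul, add_zero, one_smul] at h6
    have h7 : a + δ • w + t • (b - a) = s • a + t • b + δ • w := by
      rw [← eq_sub_iff_add_eq] at hst
      rw [hst]
      module
    have h8 : a + δ • w + (b - a) = b + δ • w := by abel
    rwa [h7, h8] at h6
  have hl : Tendsto (fun δ : ℝ => u (s • a + t • b + δ • w)) (𝓝[≠] 0) (𝓝 (u (s • a + t • b))) := by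
    have : Continuous fun δ : ℝ => u (s • a + t • b + δ • w) := by fun_prop
    simpa using (this.tendsto 0).mono_left nhdsWithin_le_nhds
  have hr : Tendsto (fun δ : ℝ => s * u (a + δ • w) + t * u (b + δ • w)) (𝓝[≠] 0)
      (𝓝 (s * u a + t * u b)) := by
    have : Continuous fun δ : ℝ => s * u (a + δ • w) + t * u (b + δ • w) := by fun_prop
    simpa using (this.tendsto 0).mono_left nhdsWithin_le_nhds
  exact le_of_tendsto_of_tendsto hl hr (eventually_mem_nhdsWithin.mono hδ)

/-- A continuous function which is positively homogeneous of degree one and `C²` away from the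
origin is convex if and only if its second derivatives at the points of the unit sphere in the
tangential directions are nonnegative. -/
theorem convexOn_univ_iff_fderiv_fderiv_nonneg (hd : 2 < finrank ℝ E) (hcont : Continuous u)
    (hom : ∀ t : ℝ, 0 < t → ∀ y ≠ 0, u (t • y) = t * u y) (hu : ContDiffOn ℝ 2 u {0}ᶜ) :
    ConvexOn ℝ univ u ↔
      ∀ x ξ : E, ‖x‖ = 1 → ‖ξ‖ = 1 → ⟪ξ, x⟫ = 0 → 0 ≤ fderiv ℝ (fderiv ℝ u) x ξ ξ :=
  ⟨fun hc _ _ hx _ h =>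
    fderiv_fderiv_nonneg_of_convexOn hc hu (norm_ne_zero_iff.1 (by simp [hx])) h,
  fun h => convexOn_univ_of_fderiv_fderiv_nonneg hd hcont hu fun _ hy η =>
    fderiv_fderiv_nonneg_of_homogeneous hom hu h hy η⟩

end Convexity

end

/-- convexity criterion via the spherical kernel `ω̂`. -/
theorem stmt_8 (n : ℕ) (hn : 2 ≤ n) (α : ℝ) (hα : 0 < α) (hα1 : α < 1)
    (f u : EuclideanSpace ℝ (Fin (n + 1)) → ℝ) (C : NNReal)
    (hf_pos : ∀ x ∈ sphere (0 : EuclideanSpace ℝ (Fin (n + 1))) 1, 0 < f x)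
    (hf_hold : HolderOnWith C ⟨α, hα.le⟩ f (sphere (0 : EuclideanSpace ℝ (Fin (n + 1))) 1))
    (hf_hom : ∀ t : ℝ, 0 < t → ∀ y : EuclideanSpace ℝ (Fin (n + 1)), y ≠ 0 →
      f (t • y) = t⁻¹ * f y)
    (hu_cont : Continuous u)
    (hu_hom : ∀ t : ℝ, 0 < t → ∀ y : EuclideanSpace ℝ (Fin (n + 1)), y ≠ 0 →
      u (t • y) = t * u y)
    (hu_C2 : ContDiffOn ℝ 2 u {(0 : EuclideanSpace ℝ (Fin (n + 1)))}ᶜ)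
    (hu_lap : ∀ x : EuclideanSpace ℝ (Fin (n + 1)), x ≠ 0 → laplacian u x = f x) :
    (∀ x ∈ sphere (0 : EuclideanSpace ℝ (Fin (n + 1))) 1,
      ∀ ξ ∈ sphere (0 : EuclideanSpace ℝ (Fin (n + 1))) 1, ⟪ξ, x⟫ = 0 →
        Integrable (fun z : sphere (0 : EuclideanSpace ℝ (Fin (n + 1))) 1 =>
          omegaHat n x ξ (z : EuclideanSpace ℝ (Fin (n + 1))) *
            (f (z : EuclideanSpace ℝ (Fin (n + 1))) - f x)) (sphereMeasure n))
    ∧ (ConvexOn ℝ Set.univ u ↔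
        ∀ x ∈ sphere (0 : EuclideanSpace ℝ (Fin (n + 1))) 1,
          ∀ ξ ∈ sphere (0 : EuclideanSpace ℝ (Fin (n + 1))) 1, ⟪ξ, x⟫ = 0 →
            0 ≤ (∫ z : sphere (0 : EuclideanSpace ℝ (Fin (n + 1))) 1,
                omegaHat n x ξ (z : EuclideanSpace ℝ (Fin (n + 1))) *
                  (f (z : EuclideanSpace ℝ (Fin (n + 1))) - f x) ∂(sphereMeasure n))
              + f x / n) := by
  have hf (x : EuclideanSpace ℝ (Fin (n + 1))) (hx : ‖x‖ = 1) (z : EuclideanSpace ℝ (Fin (n + 1)))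
      (hz : ‖z‖ = 1) : |f z - f x| ≤ C * ‖z - x‖ ^ α := by
    have := hf_hold.dist_le (mem_sphere_zero_iff_norm.2 hz) (mem_sphere_zero_iff_norm.2 hx)
    rwa [Real.dist_eq, dist_eq_norm] at this
  have key {x ξ : EuclideanSpace ℝ (Fin (n + 1))} (hx : ‖x‖ = 1) (hξ : ‖ξ‖ = 1) (h : ⟪ξ, x⟫ = 0) :=
    integral_omegaHat_mul_sub hn hα hf_hom hu_hom hu_C2 hu_lap hx hξ h (hf x hx)
  refine ⟨fun x hx ξ hξ h => (key (mem_sphere_zero_iff_norm.1 hx)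
    (mem_sphere_zero_iff_norm.1 hξ) h).1, ?_⟩
  rw [convexOn_univ_iff_fderiv_fderiv_nonneg (by rw [finrank_euclideanSpace_fin]; omega) hu_cont
    hu_hom hu_C2]
  simp only [mem_sphere_zero_iff_norm]
  exact ⟨fun H x hx ξ hξ h => (H x ξ hx hξ h).trans_eq (key hx hξ h).2.symm,
    fun H x ξ hx hξ h => (H x hx ξ hξ h).trans_eq (key hx hξ h).2⟩
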